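/- arXiv:2210.07363 — 4 statements merged into one kernel-verified Lean document; each statement's English description precedes it below -/
import Mathlib

section
/- For every finite simple graph G there exists a proper edge colouring c of G with positive integer colours (every edge is coloured and any two distinct edges sharing an endpoint receive distinct colours) such that every edge uv satisfies c(uv) ≤ max(d(u), d(v)) + 1, i.e., every edge uv receives a colour from the list {1, 2, …, max(d(u), d(v)) + 1}. -/
open SimpleGraph

section Rotation

variable {V : Type*} [DecidableEq V]

/-- Exchange the values of `f` on the pairs `uv` and `vw`. -/
def rotateAt (f : V → V → ℕ) (u v w : V) (r s : V) : ℕ :=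
  if r = v then f v (Equiv.swap u w s) else if s = v then f (Equiv.swap u w r) v else f r s

/-- The involution on ordered pairs that underlies `rotateAt`. -/
def rotatePair (u v w : V) (p : V × V) : V × V :=
  if p.1 = v then (v, Equiv.swap u w p.2)
  else if p.2 = v then (Equiv.swap u w p.1, v) else p

theorem rotateAt_eq (f : V → V → ℕ) (u v w : V) (p : V × V) :
    rotateAt f u v w p.1 p.2 = f (rotatePair u v w p).1 (rotatePair u v w p).2 := by
  simp only [rotateAt, rotatePair]
  split_ifs <;> rfl

theorem rotatePair_rotatePair {u v w : V} (hu : u ≠ v) (hw : w ≠ v) (p : V × V) :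
    rotatePair u v w (rotatePair u v w p) = p := by
  obtain ⟨r, s⟩ := p
  simp only [rotatePair, Equiv.swap_apply_def]
  grind

/-- In a graph of maximum degree at most two, three vertices of degree at most one are not all in
the same component. -/
theorem exists_closed_of_degree_le {R : V → V → Prop} (hR : ∀ r s, R r s → R s r)
    (A : Finset V) {x p q : V} (hx : x ∈ A) (hp : p ∈ A) (hq : q ∈ A)
    (hxp : x ≠ p) (hxq : x ≠ q) (hpq : p ≠ q)
    (hx1 : ∀ s ∈ A, ∀ t ∈ A, R x s → R x t → s = t)
    (hp1 : ∀ s ∈ A, ∀ t ∈ A, R p s → R p t → s = t)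
    (hq1 : ∀ s ∈ A, ∀ t ∈ A, R q s → R q t → s = t)
    (h2 : ∀ r ∈ A, ∀ s ∈ A, ∀ t ∈ A, ∀ o ∈ A, R r s → R r t → R r o →
      s = t ∨ s = o ∨ t = o) :
    ∃ K ⊆ A, x ∉ K ∧ (p ∈ K ∨ q ∈ K) ∧ ∀ r ∈ K, ∀ s ∈ A, R r s → s ∈ K := by
  induction hn : A.card generalizing A x with
  | zero => simp [Finset.card_eq_zero.1 hn] at hx
  | succ n ih =>
    by_cases hnb : ∃ x' ∈ A, x' ≠ x ∧ R x x'
    · obtain ⟨x', hx', hne, hxx'⟩ := hnb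
      have hx'x := hR _ _ hxx'
      by_cases h : x' = p ∨ x' = q
      · refine ⟨(A.erase x).erase x', fun r hr => by grind, by grind, by grind,
          fun r hr s hs hrs => ?_⟩
        have hsr := hR _ _ hrs
        grind
      · push Not at h
        obtain ⟨K, hKA, hxK, hpq', hK⟩ := ih (A.erase x) (x := x') (by grind) (by grind)
          (by grind) h.1 h.2 (by grind) (by grind) (by grind) (by grind) (by grind)
        refine ⟨K, by grind, by grind, hpq', fun r hr s hs hrs => ?_⟩
        have hsr := hR _ _ hrs
        grind
    · push Not at hnb
      refine ⟨A.erase x, by grind, by grind, by grind, fun r hr s hs hrs => ?_⟩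
      have hsr := hR _ _ hrs
      grind

end Rotation

section LocalVizing

variable {V : Type*} [Fintype V] {G : SimpleGraph V} [DecidableRel G.Adj]

/-- A partial proper edge colouring with local colour bounds, as a symmetric function on pairs of
vertices; the value `0` means that the pair is uncoloured. -/
structure IsPartialColouring (G : SimpleGraph V) [DecidableRel G.Adj] (f : V → V → ℕ) : Prop where
  symm : ∀ r s, f r s = f s r
  adj : ∀ {r s}, f r s ≠ 0 → G.Adj r s
  le : ∀ r s, f r s ≤ max (G.degree r) (G.degree s) + 1
  proper : ∀ {r s t}, f r s = f r t → f r s ≠ 0 → s = t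

/-- The ordered pairs that receive a colour. -/
def colouredPairs (f : V → V → ℕ) : Finset (V × V) :=
  Finset.univ.filter fun p => f p.1 p.2 ≠ 0

/-- The ordered pairs whose colour is too large for the degree of the first vertex. -/
def excessPairs (G : SimpleGraph V) [DecidableRel G.Adj] (f : V → V → ℕ) : Finset (V × V) :=
  Finset.univ.filter fun p => G.degree p.1 + 1 < f p.1 p.2

/-- A partial colouring with as many coloured edges as possible and, subject to that, as few
excess pairs as possible. -/
structure IsOptimal (G : SimpleGraph V) [DecidableRel G.Adj] (f : V → V → ℕ) : Prop
    extends IsPartialColouring G f where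
  card_le : ∀ g, IsPartialColouring G g → (colouredPairs g).card ≤ (colouredPairs f).card
  excess_le : ∀ g, IsPartialColouring G g → (colouredPairs g).card = (colouredPairs f).card →
    (excessPairs G f).card ≤ (excessPairs G g).card

theorem exists_isOptimal (G : SimpleGraph V) [DecidableRel G.Adj] :
    ∃ f : V → V → ℕ, IsOptimal G f := by
  classical
  have h0 : IsPartialColouring G (fun _ _ : V => 0) :=
    ⟨fun _ _ => rfl, fun h => absurd rfl h, fun _ _ => Nat.zero_le _, fun _ h => absurd rfl h⟩
  let P : ℕ → Prop := fun n => ∃ f, IsPartialColouring G f ∧ (colouredPairs f).card = n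
  have hb : ∀ n, P n → n ≤ Fintype.card (V × V) := by
    rintro n ⟨f, -, rfl⟩
    exact Finset.card_le_univ _
  have hN : P (Nat.findGreatest P (Fintype.card (V × V))) :=
    Nat.findGreatest_spec (hb _ ⟨_, h0, rfl⟩) ⟨_, h0, rfl⟩
  set N := Nat.findGreatest P (Fintype.card (V × V)) with hNdef
  let Q : ℕ → Prop := fun n => ∃ f, IsPartialColouring G f ∧ (colouredPairs f).card = N ∧
    (excessPairs G f).card = n
  have hQ : ∃ n, Q n := by
    obtain ⟨f, hf, hc⟩ := hN
    exact ⟨_, f, hf, hc, rfl⟩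
  obtain ⟨f, hf, hc, he⟩ := Nat.find_spec hQ
  refine ⟨f, hf, fun g hg => ?_, fun g hg hgc => ?_⟩
  · rw [hc, hNdef]
    exact Nat.le_findGreatest (hb _ ⟨g, hg, rfl⟩) ⟨g, hg, rfl⟩
  · rw [he]
    exact Nat.find_min' hQ ⟨g, hg, hgc.trans hc, rfl⟩

theorem IsPartialColouring.exists_missing {f : V → V → ℕ} (hf : IsPartialColouring G f) (v : V) :
    ∃ a, 0 < a ∧ a ≤ G.degree v + 1 ∧ ∀ s, f v s ≠ a := by
  by_contra! hcon
  have hsub : Finset.Icc 1 (G.degree v + 1) ⊆ (G.neighborFinset v).image (f v) := by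
    intro a ha
    rw [Finset.mem_Icc] at ha
    obtain ⟨s, hs⟩ := hcon a (by omega) ha.2
    exact Finset.mem_image.2 ⟨s, (G.mem_neighborFinset v s).2 (hf.adj (by omega)), hs⟩
  have h1 := (Finset.card_le_card hsub).trans Finset.card_image_le
  rw [Nat.card_Icc, G.card_neighborFinset_eq_degree] at h1
  omega

variable [DecidableEq V]

/-- In an optimal partial colouring, an uncoloured edge has no admissible colour that is missing
at both of its ends. -/
theorem IsOptimal.not_both_missing {f : V → V → ℕ} (hf : IsOptimal G f) {u v : V} {a : ℕ}
    (huv : G.Adj u v) (h0 : f u v = 0) (ha : 0 < a)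
    (hle : a ≤ max (G.degree u) (G.degree v) + 1)
    (hu : ∀ s, f u s ≠ a) (hv : ∀ s, f v s ≠ a) : False := by
  have hne : u ≠ v := huv.ne
  have hsymm := hf.symm
  let g : V → V → ℕ := fun r s => if (r = u ∧ s = v) ∨ (r = v ∧ s = u) then a else f r s
  have hg : IsPartialColouring G g := by
    refine ⟨fun r s => ?_, fun {r s} h => ?_, fun r s => ?_, fun {r s t} h h' => ?_⟩
    · have := hsymm r s
      simp only [g]; grind
    · have := hf.adj (r := r) (s := s)
      have := huv.symm
      simp only [g] at h; grind
    · have := hf.le r s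
      simp only [g]; grind
    · have := hf.proper (r := r) (s := s) (t := t)
      simp only [g] at h h'; grind
  have hlt : (colouredPairs f).card < (colouredPairs g).card := by
    apply Finset.card_lt_card
    refine Finset.ssubset_iff_subset_ne.2 ⟨fun p hp => ?_, fun h => ?_⟩
    · simp only [colouredPairs, Finset.mem_filter, Finset.mem_univ, true_and, g] at hp ⊢
      grind
    · have h1 : (u, v) ∈ colouredPairs g := by
        simp [colouredPairs, g, ha.ne']
      rw [← h] at h1
      simp [colouredPairs, h0] at h1
  exact absurd (hf.card_le g hg) (by omega)

theorem card_colouredPairs_rotateAt (f : V → V → ℕ) {u v w : V} (hu : u ≠ v) (hw : w ≠ v) :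
    (colouredPairs (rotateAt f u v w)).card = (colouredPairs f).card := by
  have hinv := rotatePair_rotatePair hu hw
  refine Finset.card_bij' (fun p _ => rotatePair u v w p) (fun p _ => rotatePair u v w p)
    (fun p hp => ?_) (fun p hp => ?_) (fun p _ => hinv p) (fun p _ => hinv p)
  · simpa [colouredPairs, rotateAt_eq] using hp
  · simpa [colouredPairs, rotateAt_eq, hinv] using hp

/-- Moving the uncoloured edge from `uv` to `vw` by giving `uv` the colour of `vw` preserves
optimality, and the colour of `vw` was small compared with the degree of `w`. -/
theorem IsOptimal.rotate {f : V → V → ℕ} (hf : IsOptimal G f) {u v w : V} {a : ℕ}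
    (huv : G.Adj u v) (h0 : f u v = 0) (ha : 0 < a) (hle : a ≤ G.degree u + 1)
    (hu : ∀ s, f u s ≠ a) (hw : f v w = a) :
    IsOptimal G (rotateAt f u v w) ∧ a ≤ G.degree w + 1 := by
  have hne : u ≠ v := huv.ne
  have hvw : G.Adj v w := hf.adj (by omega)
  have hne' : w ≠ v := hvw.ne'
  have hinv := rotatePair_rotatePair hne hne'
  have hsymm := hf.symm
  have huw : u ≠ w := by rintro rfl; have := hsymm u v; omega
  have hg : IsPartialColouring G (rotateAt f u v w) := by
    refine ⟨fun r s => ?_, fun {r s} h => ?_, fun r s => ?_, fun {r s t} h h' => ?_⟩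
    · have h1 := hsymm r s
      have h2 := hsymm v u
      have h3 := hsymm v w
      have h4 := hsymm r v
      have h5 := hsymm v s
      simp only [rotateAt, Equiv.swap_apply_def]; grind
    · have h1 := hf.adj (r := r) (s := s)
      have h2 := huv.symm
      have h3 := hsymm v u
      have h4 := hsymm v w
      simp only [rotateAt, Equiv.swap_apply_def] at h; grind
    · have h1 := hf.le r s
      have h3 := hsymm v u
      have h4 := hsymm v w
      simp only [rotateAt, Equiv.swap_apply_def]; grind
    · have h1 := hf.proper (r := r) (s := s) (t := t)
      have h2 := hf.proper (r := v) (s := Equiv.swap u w s) (t := Equiv.swap u w t)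
      have h3 := hsymm v u
      have h4 := hsymm v w
      by_cases hr : r = v
      · simp only [rotateAt, hr, if_true] at h h'
        exact (Equiv.swap u w).injective (h2 h h')
      · simp only [rotateAt, Equiv.swap_apply_def] at h h'; grind
  have hcard := card_colouredPairs_rotateAt f hne hne'
  have huv_mem : (u, v) ∉ excessPairs G (rotateAt f u v w) := by
    have h1 : rotateAt f u v w u v = a := by
      simp [rotateAt, hne, hsymm w v, hw]
    simp only [excessPairs, Finset.mem_filter, Finset.mem_univ, true_and, h1]
    omega
  have hmaps : ∀ p ∈ excessPairs G (rotateAt f u v w),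
      rotatePair u v w p ∈ excessPairs G f := by
    rintro ⟨r, s⟩ hp
    have hp' : (r, s) ≠ (u, v) := fun h => huv_mem (h ▸ hp)
    have h3 := hsymm v u
    simp only [excessPairs, Finset.mem_filter, Finset.mem_univ, true_and, rotateAt,
      rotatePair, Equiv.swap_apply_def] at hp ⊢
    grind
  have himage : ((excessPairs G (rotateAt f u v w)).image (rotatePair u v w)).card =
      (excessPairs G (rotateAt f u v w)).card :=
    Finset.card_image_of_injective _ (Function.LeftInverse.injective hinv)
  have hsub : (excessPairs G (rotateAt f u v w)).image (rotatePair u v w) ⊆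
      excessPairs G f := Finset.image_subset_iff.2 hmaps
  have hexcess := Finset.card_le_card hsub
  refine ⟨⟨hg, fun g hg' => hcard ▸ hf.card_le g hg', fun g hg' hc => ?_⟩, ?_⟩
  · have := hf.excess_le g hg' (hc.trans hcard)
    omega
  · by_contra! hlt
    have hmem : (w, v) ∈ excessPairs G f := by
      simp only [excessPairs, Finset.mem_filter, Finset.mem_univ, true_and]
      rw [hsymm, hw]; exact hlt
    have heq := Finset.eq_of_subset_of_card_le hsub
      (by have := hf.excess_le _ hg hcard; omega)
    rw [← heq, Finset.mem_image] at hmem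
    obtain ⟨p, hp, hpe⟩ := hmem
    have : p = (u, v) := by
      rw [← hinv p, hpe]
      simp [rotatePair, hne']
    exact huv_mem (this ▸ hp)

/-- Kempe chain argument: in an optimal partial colouring, if `uv` is uncoloured, `u` misses `a`
and `v` misses `b`, then `u` lies in every vertex set that contains `v` and is closed under
following edges of colours `a` and `b`. -/
theorem IsOptimal.mem_of_closed {f : V → V → ℕ} (hf : IsOptimal G f) {u v : V} {a b : ℕ}
    (huv : G.Adj u v) (h0 : f u v = 0) (ha : 0 < a) (hb : 0 < b)
    (hale : a ≤ G.degree u + 1) (hble : b ≤ G.degree v + 1)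
    (hu : ∀ s, f u s ≠ a) (hv : ∀ s, f v s ≠ b) (K : Finset V) (hvK : v ∈ K)
    (hK : ∀ r ∈ K, ∀ s, f r s = a ∨ f r s = b → s ∈ K) : u ∈ K := by
  induction hn : K.card generalizing f u v a b K with
  | zero => simp [Finset.card_eq_zero.1 hn] at hvK
  | succ n ih =>
    by_contra huK
    by_cases hva : ∀ s, f v s ≠ a
    · exact hf.not_both_missing huv h0 ha (by omega) hu hva
    push Not at hva
    obtain ⟨w, hw⟩ := hva
    obtain ⟨hopt, hwle⟩ := hf.rotate huv h0 ha hale hu hw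
    have hsymm := hf.symm
    have hvw : G.Adj v w := hf.adj (by omega)
    have hne : u ≠ v := huv.ne
    have hne' : w ≠ v := hvw.ne'
    have hvu := hsymm v u
    have hwv := hsymm w v
    have hwK : w ∈ K := hK v hvK w (Or.inl hw)
    have huw : u ≠ w := by rintro rfl; omega
    refine absurd (ih hopt hvw ?_ hb ha hble hwle (fun s => ?_) (fun s hs => ?_) (K.erase v)
      (Finset.mem_erase.2 ⟨hne', hwK⟩) (fun r hr s hs => ?_) ?_) (Finset.notMem_erase v K)
    · simp [rotateAt, h0, hvu]
    · simp only [rotateAt, if_true]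
      exact hv _
    · have := hf.proper (r := w) (s := s) (t := v)
      simp only [rotateAt, Equiv.swap_apply_def] at hs
      grind
    · have h1 := hf.proper (r := v) (s := r) (t := w)
      have h2 := hsymm v r
      have h3 := hK r (Finset.mem_of_mem_erase hr) s
      have h4 := hv r
      have hrv := Finset.ne_of_mem_erase hr
      have hrK := Finset.mem_of_mem_erase hr
      have hru : r ≠ u := by rintro rfl; exact huK hrK
      rw [Finset.mem_erase]
      simp only [rotateAt, Equiv.swap_apply_def] at hs
      grind
    · rw [Finset.card_erase_of_mem hvK]; omega

/-- A Vizing fan `y 0, …, y k` at `x`: the edge from `x` to `y 0` is uncoloured, the colour `m i`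
is missing at `y i`, and the edge from `x` to `y (i + 1)` has colour `m i`. -/
structure IsFan (G : SimpleGraph V) [DecidableRel G.Adj] (f : V → V → ℕ) (x : V) (y : ℕ → V)
    (m : ℕ → ℕ) (k : ℕ) : Prop where
  adj : G.Adj x (y 0)
  uncoloured : f x (y 0) = 0
  step : ∀ i < k, f x (y (i + 1)) = m i
  inj : ∀ i ≤ k, ∀ j ≤ k, y i = y j → i = j
  pos : ∀ i ≤ k, 0 < m i
  le : ∀ i ≤ k, m i ≤ G.degree (y i) + 1
  missing : ∀ i ≤ k, ∀ s, f (y i) s ≠ m i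

theorem IsFan.exists_shift {f : V → V → ℕ} {x : V} {y : ℕ → V} {m : ℕ → ℕ} {k : ℕ}
    (hf : IsOptimal G f) (h : IsFan G f x y m k) (i : ℕ) (hi : i ≤ k) :
    ∃ f', IsOptimal G f' ∧ IsFan G f' x (fun n => y (n + i)) (fun n => m (n + i)) (k - i) ∧
      (∀ r s, r ≠ x → s ≠ x → f' r s = f r s) ∧
      (∀ s, f' x s ≠ 0 → ∃ t, f x t = f' x s) ∧ (0 < i → f' x (y 0) = m 0) := by
  induction i with
  | zero => exact ⟨f, hf, h, fun _ _ _ _ => rfl, fun s _ => ⟨s, rfl⟩, fun h => absurd h (by simp)⟩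
  | succ i ih =>
    obtain ⟨g, hg, hfan, hoff, hcol, h0⟩ := ih (by omega)
    have hstep := hfan.step 0 (by omega)
    have hpos := hfan.pos 0 (by omega)
    have hle := h.le i (by omega)
    have hmiss := hfan.missing 0 (by omega)
    have hadj := hfan.adj
    have hunc := hfan.uncoloured
    simp only [Nat.zero_add] at hstep hpos hmiss hadj hunc
    rw [Nat.add_comm 1 i] at hstep
    have hsymm := hg.symm
    have hinj : ∀ n ≤ k, ∀ n' ≤ k, y n = y n' → n = n' := h.inj
    have hopt := (hg.rotate hadj.symm ((hsymm _ _).trans hunc) hpos hle hmiss hstep).1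
    have hx1 : G.Adj x (y (i + 1)) := hg.adj (by omega)
    have hxy : ∀ n, n + (i + 1) ≤ k → x ≠ y (n + (i + 1)) := by
      intro n hn
      have h1 := hfan.step n (by omega)
      have h2 := hfan.pos n (by omega)
      refine (hg.adj (s := y (n + (i + 1))) ?_).ne
      rw [show n + (i + 1) = n + 1 + i by omega]
      omega
    have hi1 : y i ≠ y (i + 1) := fun h => by have := hinj _ (by omega) _ (by omega) h; omega
    refine ⟨_, hopt, ⟨?_, ?_, fun n hn => ?_, fun n hn n' hn' he => ?_, fun n hn => ?_,
      fun n hn => ?_, fun n hn s hs => ?_⟩, fun r s hr hs => ?_, fun s hs => ?_, fun _ => ?_⟩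
    · simpa using hx1
    · simp [rotateAt, hunc]
    · have h1 := hfan.step (n + 1) (by omega)
      have hn1 : y (n + 1 + (i + 1)) ≠ y i := fun h => by
        have := hinj _ (by omega) _ (by omega) h; omega
      have hn2 : y (n + 1 + (i + 1)) ≠ y (i + 1) := fun h => by
        have := hinj _ (by omega) _ (by omega) h; omega
      simp only [rotateAt, if_true]
      rw [Equiv.swap_apply_of_ne_of_ne hn1 hn2]
      rw [show n + 1 + (i + 1) = n + 1 + 1 + i by omega, h1]
      congr 1; omega
    · have := hinj _ (by omega) _ (by omega) he; omega
    · exact h.pos _ (by omega)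
    · exact h.le _ (by omega)
    · have h1 := hfan.missing (n + 1) (by omega)
      have h2 := h.pos (n + (i + 1)) (by omega)
      have hxn := hxy n (by omega)
      have hn1 : y (n + (i + 1)) ≠ y i := fun h => by
        have := hinj _ (by omega) _ (by omega) h; omega
      rw [show n + 1 + i = n + (i + 1) by omega] at h1
      have h3 := h1 s
      have h4 := hsymm (y i) x
      simp only [rotateAt, Equiv.swap_apply_def] at hs
      grind
    · rw [← hoff r s hr hs]
      simp [rotateAt, hr, hs]
    · simp only [rotateAt, if_true] at hs ⊢
      exact hcol _ hs
    · rcases Nat.eq_zero_or_pos i with rfl | hpos'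
      · simp only [rotateAt, if_true, Equiv.swap_apply_left]
        exact hstep
      · have hn1 : y 0 ≠ y i := fun h => by
          have := hinj _ (by omega) _ (by omega) h; omega
        have hn2 : y 0 ≠ y (i + 1) := fun h => by
          have := hinj _ (by omega) _ (by omega) h; omega
        simp only [rotateAt, if_true]
        rw [Equiv.swap_apply_of_ne_of_ne hn1 hn2]
        exact h0 hpos'

theorem IsFan.exists_eq_last {f : V → V → ℕ} {x : V} {y : ℕ → V} {m : ℕ → ℕ} {k : ℕ}
    (hf : IsOptimal G f) (h : IsFan G f x y m k) : ∃ v, f x v = m k := by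
  obtain ⟨g, hg, hfan, -, hcol, -⟩ := h.exists_shift hf k le_rfl
  have hmiss := hfan.missing 0 (by omega)
  have hadj := hfan.adj
  have hunc := hfan.uncoloured
  simp only [Nat.zero_add] at hmiss hadj hunc
  have hle := h.le k le_rfl
  have hpos := h.pos k le_rfl
  by_contra! hne
  refine hg.not_both_missing hadj hunc hpos (by omega) (fun s hs => ?_) hmiss
  obtain ⟨t, ht⟩ := hcol s (by omega)
  exact hne t (ht.trans hs)

theorem IsFan.first_ne_last {f : V → V → ℕ} {x : V} {y : ℕ → V} {m : ℕ → ℕ} {k : ℕ}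
    (hf : IsOptimal G f) (h : IsFan G f x y m k) (hk : 0 < k) : m 0 ≠ m k := by
  intro hm
  obtain ⟨a, ha, hale, hax⟩ := hf.exists_missing x
  have hsymm := hf.symm
  have hb := h.pos 0 (by omega)
  have hb' := h.le 0 (by omega)
  have hmiss0 := h.missing 0 (by omega)
  have hmissk := h.missing k le_rfl
  rw [← hm] at hmissk
  have hxk : G.Adj x (y k) := by
    have h1 := h.step (k - 1) (by omega)
    have h2 := h.pos (k - 1) (by omega)
    rw [Nat.sub_add_cancel hk] at h1
    exact hf.adj (by omega)
  have h0k : y 0 ≠ y k := fun he => by have := h.inj _ (by omega) _ le_rfl he; omega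
  obtain ⟨K, -, hxK, hyK, hK⟩ := exists_closed_of_degree_le
    (R := fun r s => f r s = a ∨ f r s = m 0) (fun r s hrs => by rwa [hsymm s r])
    Finset.univ (Finset.mem_univ x) (Finset.mem_univ (y 0)) (Finset.mem_univ (y k))
    h.adj.ne hxk.ne h0k
    (fun s _ t _ hs ht => by
      have := hf.proper (r := x) (s := s) (t := t); grind)
    (fun s _ t _ hs ht => by
      have := hf.proper (r := y 0) (s := s) (t := t); grind)
    (fun s _ t _ hs ht => by
      have := hf.proper (r := y k) (s := s) (t := t); grind)
    (fun r _ s _ t _ o _ hs ht ho => by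
      have h1 := hf.proper (r := r) (s := s) (t := t)
      have h2 := hf.proper (r := r) (s := s) (t := o)
      have h3 := hf.proper (r := r) (s := t) (t := o)
      grind)
  by_cases hy0 : y 0 ∈ K
  · exact hxK (hf.mem_of_closed h.adj h.uncoloured ha hb hale hb' hax hmiss0 K hy0
      fun r hr s hs => hK r hr s (Finset.mem_univ s) hs)
  · have hyk : y k ∈ K := hyK.resolve_left hy0
    obtain ⟨g, hg, hfan, hoff, hcol, hg0⟩ := h.exists_shift hf k le_rfl
    have hmiss := hfan.missing 0 (by omega)
    have hunc := hfan.uncoloured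
    simp only [Nat.zero_add] at hmiss hunc
    rw [← hm] at hmiss
    have hgx : ∀ s, g x s ≠ a := fun s hs => by
      obtain ⟨t, ht⟩ := hcol s (by omega)
      exact hax t (ht.trans hs)
    refine hxK (hg.mem_of_closed hxk hunc ha hb hale (hm ▸ h.le k le_rfl) hgx hmiss K hyk
      fun r hr s hs => ?_)
    have hrx : r ≠ x := by rintro rfl; exact hxK hr
    by_cases hsx : s = x
    · subst hsx
      rw [hg.symm] at hs
      rcases hs with hs | hs
      · exact absurd hs (hgx r)
      · have : r = y 0 := hg.proper (hs.trans (hg0 hk).symm) (by omega)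
        exact absurd (this ▸ hr) hy0
    · rw [hoff r s hrx hsx] at hs
      exact hK r hr s (Finset.mem_univ s) hs

theorem IsFan.colours_ne_last {f : V → V → ℕ} {x : V} {y : ℕ → V} {m : ℕ → ℕ} {k : ℕ}
    (hf : IsOptimal G f) (h : IsFan G f x y m k) {j : ℕ} (hj : j < k) : m j ≠ m k := by
  obtain ⟨g, hg, hfan, -, -, -⟩ := h.exists_shift hf j hj.le
  have := hfan.first_ne_last hg (by omega)
  simpa [Nat.sub_add_cancel hj.le] using this

/-- An optimal partial colouring colours every edge. -/
theorem IsOptimal.ne_zero {f : V → V → ℕ} (hf : IsOptimal G f) {x v : V} (hxv : G.Adj x v) :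
    f x v ≠ 0 := by
  classical
  intro h0
  choose c hcpos hcle hcmiss using hf.exists_missing
  let next : V → V := fun z => if h : ∃ t, f x t = c z then h.choose else z
  let y : ℕ → V := fun n => next^[n] v
  have hy : ∀ n, (∃ t, f x t = c (y n)) → f x (y (n + 1)) = c (y n) := by
    intro n hn
    have : y (n + 1) = next (y n) := Function.iterate_succ_apply' next n v
    rw [this]
    simp only [next, dif_pos hn]
    exact hn.choose_spec
  have hfan : ∀ k, IsFan G f x y (fun n => c (y n)) k := by
    intro k
    induction k with
    | zero =>
      exact ⟨hxv, h0, fun i hi => absurd hi (by omega), fun i hi j hj _ => by omega,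
        fun _ _ => hcpos _, fun _ _ => hcle _, fun _ _ => hcmiss _⟩
    | succ k ih =>
      have hlast := hy k (ih.exists_eq_last hf)
      have hnew : ∀ j ≤ k, y j ≠ y (k + 1) := by
        intro j hj he
        have hpos := hcpos (y k)
        rcases j with _ | j
        · rw [← he] at hlast
          have : f x (y 0) = 0 := h0
          omega
        · have h1 := ih.step j (by omega)
          rw [he, hlast] at h1
          exact ih.colours_ne_last hf (show j < k by omega) h1.symm
      refine ⟨hxv, h0, fun i hi => ?_, fun i hi j hj he => ?_, fun _ _ => hcpos _,
        fun _ _ => hcle _, fun _ _ => hcmiss _⟩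
      · rcases Nat.lt_succ_iff_lt_or_eq.1 hi with hi | rfl
        · exact ih.step i hi
        · exact hlast
      · rcases Nat.lt_or_ge k i with hki | hki <;> rcases Nat.lt_or_ge k j with hkj | hkj
        · omega
        · obtain rfl : i = k + 1 := by omega
          exact absurd he.symm (hnew j hkj)
        · obtain rfl : j = k + 1 := by omega
          exact absurd he (hnew i hki)
        · exact ih.inj i hki j hkj he
  have hinj : Function.Injective y := fun i j he =>
    (hfan (max i j)).inj i (le_max_left _ _) j (le_max_right _ _) he
  exact not_injective_infinite_finite y hinj

end LocalVizing

/-- **Local Vizing Theorem** (conjecture of Bonamy, Delcourt, Lang and Postle).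
For every finite simple graph `G` there exists a proper edge colouring with positive
integer colours such that every edge `uv` receives a colour from
`{1, …, max (d u) (d v) + 1}`. -/
theorem local_vizing_theorem (V : Type*) [Fintype V] [DecidableEq V]
    (G : SimpleGraph V) [DecidableRel G.Adj] :
    ∃ c : Sym2 V → ℕ,
      (∀ e₁ ∈ G.edgeSet, ∀ e₂ ∈ G.edgeSet, e₁ ≠ e₂ →
        (∃ z, z ∈ e₁ ∧ z ∈ e₂) → c e₁ ≠ c e₂) ∧
      ∀ u v : V, G.Adj u v →
        1 ≤ c s(u, v) ∧ c s(u, v) ≤ max (G.degree u) (G.degree v) + 1 := by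
  obtain ⟨f, hf⟩ := exists_isOptimal G
  refine ⟨Sym2.lift ⟨f, hf.symm⟩, ?_, fun u v huv => ?_⟩
  · rintro e₁ he₁ e₂ - hne ⟨z, ⟨s, rfl⟩, ⟨t, rfl⟩⟩ heq
    simp only [Sym2.lift_mk] at heq
    exact hne (by rw [hf.proper heq (hf.ne_zero he₁)])
  · simp only [Sym2.lift_mk]
    exact ⟨Nat.one_le_iff_ne_zero.2 (hf.ne_zero huv), hf.le u v⟩
end

section
/- Let G be a finite simple graph, let c be a strictly local proper partial edge colouring of G, and let e be an edge of G left uncoloured by c. Then there exists a strictly local proper partial edge colouring c' of G whose set of coloured edges is exactly the set of edges coloured by c together with e. -/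
open SimpleGraph

variable {V : Type*}

/-- A proper partial edge colouring: every coloured element is an edge, colours are
positive integers, and two distinct edges sharing an endpoint never receive the
same colour. -/
def IsProperPartial (G : SimpleGraph V) (c : Sym2 V → Option ℕ) : Prop :=
  (∀ e κ, c e = some κ → e ∈ G.edgeSet ∧ 1 ≤ κ) ∧
  ∀ e₁ e₂ κ, e₁ ≠ e₂ → (∃ z, z ∈ e₁ ∧ z ∈ e₂) → c e₁ = some κ → c e₂ ≠ some κ

/-- A partial edge colouring is strictly local if every coloured edge `uv` receives a
colour in `{1, …, max (d u) (d v) + 1}`. -/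
def StrictlyLocal (G : SimpleGraph V) [Fintype V] [DecidableRel G.Adj]
    (c : Sym2 V → Option ℕ) : Prop :=
  ∀ u v κ, G.Adj u v → c s(u, v) = some κ → κ ≤ max (G.degree u) (G.degree v) + 1

/-- `c` is a strictly local proper partial edge colouring for which `e` is an uncoloured edge, and
`S` consists of the coloured edges together with `e`. -/
structure ColoursAllBut (G : SimpleGraph V) [Fintype V] [DecidableRel G.Adj]
    (S : Set (Sym2 V)) (c : Sym2 V → Option ℕ) (e : Sym2 V) : Prop where
  adj : ∀ {v w κ}, c s(v, w) = some κ → G.Adj v w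
  pos : ∀ {v w κ}, c s(v, w) = some κ → 1 ≤ κ
  inj : ∀ {v w w' κ}, c s(v, w) = some κ → c s(v, w') = some κ → w = w'
  strictlyLocal : StrictlyLocal G c
  mem_edgeSet : e ∈ G.edgeSet
  uncoloured : c e = none
  mem_iff : ∀ f, f ∈ S ↔ c f ≠ none ∨ f = e

/-- Some strictly local proper partial edge colouring has `S` as its set of coloured edges. -/
def Colourable (G : SimpleGraph V) [Fintype V] [DecidableRel G.Adj] (S : Set (Sym2 V)) : Prop :=
  ∃ c : Sym2 V → Option ℕ, IsProperPartial G c ∧ StrictlyLocal G c ∧ ∀ f, c f ≠ none ↔ f ∈ S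

/-- The colour `κ` does not appear at the vertex `v`. -/
def Misses (c : Sym2 V → Option ℕ) (v : V) (κ : ℕ) : Prop :=
  ∀ w, c s(v, w) ≠ some κ

/-- The incidences of a vertex `v` with a colour exceeding `d(v) + 1`. -/
def bigIncidences (G : SimpleGraph V) [Fintype V] [DecidableRel G.Adj]
    (c : Sym2 V → Option ℕ) : Set (V × ℕ) :=
  {p | ∃ w, c s(p.1, w) = some p.2 ∧ G.degree p.1 + 1 < p.2}

/-- Move the colour of the edge `f` to the edge `e`. -/
def shift [DecidableEq V] (c : Sym2 V → Option ℕ) (e f : Sym2 V) : Sym2 V → Option ℕ :=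
  fun g => if g = e then c f else if g = f then none else c g

lemma isProperPartial_of_forall {G : SimpleGraph V} {c : Sym2 V → Option ℕ}
    (hadj : ∀ v w κ, c s(v, w) = some κ → G.Adj v w ∧ 1 ≤ κ)
    (hinj : ∀ v w w' κ, c s(v, w) = some κ → c s(v, w') = some κ → w = w') :
    IsProperPartial G c := by
  refine ⟨fun e κ => ?_, ?_⟩
  · induction e with | _ v w => exact hadj v w κ
  · rintro e₁ e₂ κ hne ⟨z, h₁, h₂⟩ hc₁ hc₂
    obtain ⟨a, rfl⟩ := Sym2.mem_iff_exists.1 h₁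
    obtain ⟨b, rfl⟩ := Sym2.mem_iff_exists.1 h₂
    exact hne (by rw [hinj z a b κ hc₁ hc₂])

lemma IsProperPartial.inj {G : SimpleGraph V} {c : Sym2 V → Option ℕ} (h : IsProperPartial G c)
    {v w w' : V} {κ : ℕ} (hw : c s(v, w) = some κ) (hw' : c s(v, w') = some κ) : w = w' := by
  by_contra hne
  exact h.2 s(v, w) s(v, w') κ (mt Sym2.congr_right.1 hne) ⟨v, by simp, by simp⟩ hw hw'

lemma not_misses_iff {c : Sym2 V → Option ℕ} {v : V} {κ : ℕ} :
    ¬ Misses c v κ ↔ ∃ w, c s(v, w) = some κ := by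
  simp [Misses]

/-- In a relation of maximum degree two with three distinct vertices of degree at most one, some
closed set avoids the first of these vertices and contains one of the others. -/
lemma exists_closed_avoiding [Fintype V] [DecidableEq V] (S : Finset V) (R : V → V → Prop)
    (hS : ∀ p q, R p q → p ∈ S) (hsymm : ∀ p q, R p q → R q p)
    (hdeg : ∀ p a b d, R p a → R p b → R p d → a = b ∨ a = d ∨ b = d)
    (z v w : V) (hzv : z ≠ v) (hzw : z ≠ w) (hvw : v ≠ w)
    (hz : ∀ a b, R z a → R z b → a = b) (hv : ∀ a b, R v a → R v b → a = b)
    (hw : ∀ a b, R w a → R w b → a = b) :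
    ∃ W : Finset V, z ∉ W ∧ (v ∈ W ∨ w ∈ W) ∧ ∀ p ∈ W, ∀ q, R p q → q ∈ W := by
  induction S using Finset.strongInduction generalizing R z with
  | H S ih =>
  by_cases hiso : ∃ z₁, z₁ ≠ z ∧ R z z₁
  swap
  · refine ⟨Finset.univ.erase z, by simp, Or.inl (by simpa using hzv.symm), fun p hp q hpq => ?_⟩
    simp only [Finset.mem_erase, Finset.mem_univ, and_true] at hp ⊢
    rintro rfl
    exact hiso ⟨p, hp, hsymm _ _ hpq⟩
  obtain ⟨z₁, hz₁, hR⟩ := hiso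
  by_cases h₁ : z₁ = v
  · subst h₁
    refine ⟨Finset.univ \ {z, z₁}, by simp, Or.inr (by simp [hzw.symm, hvw.symm]), ?_⟩
    intro p hp q hpq
    simp only [Finset.mem_sdiff, Finset.mem_univ, Finset.mem_insert, Finset.mem_singleton,
      true_and] at hp ⊢
    rintro (rfl | rfl)
    · exact hp (Or.inr (hz _ _ (hsymm _ _ hpq) hR))
    · exact hp (Or.inl (hv _ _ (hsymm _ _ hpq) (hsymm _ _ hR)))
  by_cases h₂ : z₁ = w
  · subst h₂
    refine ⟨Finset.univ \ {z, z₁}, by simp, Or.inl (by simp [hzv.symm, hvw]), ?_⟩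
    intro p hp q hpq
    simp only [Finset.mem_sdiff, Finset.mem_univ, Finset.mem_insert, Finset.mem_singleton,
      true_and] at hp ⊢
    rintro (rfl | rfl)
    · exact hp (Or.inr (hz _ _ (hsymm _ _ hpq) hR))
    · exact hp (Or.inl (hw _ _ (hsymm _ _ hpq) (hsymm _ _ hR)))
  obtain ⟨W, hzW, hvwW, hW⟩ := ih (S.erase z) (Finset.erase_ssubset (hS _ _ hR))
    (fun p q => R p q ∧ p ≠ z ∧ q ≠ z)
    (fun p q h => Finset.mem_erase.2 ⟨h.2.1, hS _ _ h.1⟩)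
    (fun p q h => ⟨hsymm _ _ h.1, h.2.2, h.2.1⟩)
    (fun p a b d ha hb hd => hdeg p a b d ha.1 hb.1 hd.1) z₁ h₁ h₂
    (fun a b ha hb => by
      rcases hdeg z₁ a b z ha.1 hb.1 (hsymm _ _ hR) with h | h | h
      · exact h
      · exact absurd h ha.2.2
      · exact absurd h hb.2.2)
    (fun a b ha hb => hv a b ha.1 hb.1) (fun a b ha hb => hw a b ha.1 hb.1)
  refine ⟨W.erase z, by simp, by simpa [hzv.symm, hzw.symm] using hvwW, fun p hp q hpq => ?_⟩
  rw [Finset.mem_erase] at hp ⊢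
  have hqz : q ≠ z := by
    rintro rfl
    exact hzW (hz _ _ hR (hsymm _ _ hpq) ▸ hp.2)
  exact ⟨hqz, hW p hp.2 q ⟨hpq, hp.1, hqz⟩⟩

section Extension

variable [Fintype V] {G : SimpleGraph V} [DecidableRel G.Adj] {S : Set (Sym2 V)}
  {c : Sym2 V → Option ℕ}

lemma bigIncidences_finite (c : Sym2 V → Option ℕ) : (bigIncidences G c).Finite := by
  refine (Set.finite_range fun p : V × V => (p.1, (c s(p.1, p.2)).getD 0)).subset ?_
  rintro ⟨v, κ⟩ ⟨w, hw, -⟩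
  exact ⟨(v, w), by simp_all⟩

variable [DecidableEq V]

/-- A vertex with an uncoloured edge misses two colours of its palette. -/
lemma ColoursAllBut.exists_misses {v u : V} (h : ColoursAllBut G S c s(v, u)) (ρ : ℕ) :
    ∃ α, α ≠ ρ ∧ 1 ≤ α ∧ α ≤ G.degree v + 1 ∧ Misses c v α := by
  have hu : u ∈ G.neighborFinset v := by simpa using h.mem_edgeSet
  set used := insert ρ (((G.neighborFinset v).erase u).image fun w => (c s(v, w)).getD 0)
    with hused
  have hcard : used.card < (Finset.Icc 1 (G.degree v + 1)).card := by
    have h₁ := Finset.card_insert_le ρ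
      (((G.neighborFinset v).erase u).image fun w => (c s(v, w)).getD 0)
    have h₂ := Finset.card_image_le (s := (G.neighborFinset v).erase u)
      (f := fun w => (c s(v, w)).getD 0)
    have h₃ := Finset.card_erase_add_one hu
    rw [G.card_neighborFinset_eq_degree] at h₃
    rw [← hused] at h₁
    rw [Nat.card_Icc]
    omega
  obtain ⟨α, hα, hα'⟩ := Finset.exists_mem_notMem_of_card_lt_card hcard
  rw [Finset.mem_Icc] at hα
  rw [hused, Finset.mem_insert, not_or] at hα'
  refine ⟨α, hα'.1, hα.1, hα.2, fun w hw => hα'.2 (Finset.mem_image.2 ⟨w, ?_, by simp [hw]⟩)⟩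
  rw [Finset.mem_erase, G.mem_neighborFinset]
  refine ⟨?_, h.adj hw⟩
  rintro rfl
  simp [h.uncoloured] at hw

/-- A colour missing at both ends of the uncoloured edge extends the colouring. -/
lemma ColoursAllBut.colourable_of_misses {x y : V} {a : ℕ} (h : ColoursAllBut G S c s(x, y))
    (hx : Misses c x a) (hy : Misses c y a) (ha : 1 ≤ a) (had : a ≤ G.degree x + 1) :
    Colourable G S := by
  have key : ∀ p q κ, Function.update c s(x, y) (some a) s(p, q) = some κ →
      (s(p, q) = s(x, y) ∧ κ = a) ∨ (s(p, q) ≠ s(x, y) ∧ c s(p, q) = some κ) := by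
    intro p q κ hκ
    by_cases hpq : s(p, q) = s(x, y)
    · rw [hpq, Function.update_self] at hκ
      exact Or.inl ⟨hpq, (Option.some.inj hκ).symm⟩
    · rw [Function.update_of_ne hpq] at hκ
      exact Or.inr ⟨hpq, hκ⟩
  refine ⟨Function.update c s(x, y) (some a), isProperPartial_of_forall ?_ ?_, ?_, ?_⟩
  · intro p q κ hκ
    rcases key p q κ hκ with ⟨he, rfl⟩ | ⟨-, hκ⟩
    · exact ⟨(G.mem_edgeSet (v := p) (w := q)).1 (he ▸ h.mem_edgeSet), ha⟩
    · exact ⟨h.adj hκ, h.pos hκ⟩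
  · intro p q q' κ hκ hκ'
    have hinj := @h.inj
    have hx' : ∀ w, c s(x, w) ≠ some a := hx
    have hy' : ∀ w, c s(y, w) ≠ some a := hy
    have hκ₁ := key p q κ hκ
    have hκ₂ := key p q' κ hκ'
    simp only [ne_eq, Sym2.eq_iff] at hκ₁ hκ₂
    grind
  · intro p q κ hpq hκ
    rcases key p q κ hκ with ⟨he, rfl⟩ | ⟨-, hκ⟩
    · rcases Sym2.eq_iff.1 he with ⟨rfl, rfl⟩ | ⟨rfl, rfl⟩ <;> omega
    · exact h.strictlyLocal p q κ hpq hκ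
  · intro f
    rw [h.mem_iff]
    by_cases hf : f = s(x, y)
    · simp [hf]
    · simp [hf]

lemma ColoursAllBut.shift_apply {x y z : V} {a : ℕ} (h : ColoursAllBut G S c s(x, y))
    (hz : c s(y, z) = some a) (p q : V) (κ : ℕ) :
    shift c s(x, y) s(y, z) s(p, q) = some κ ↔
      (κ = a ∧ (p = x ∧ q = y ∨ p = y ∧ q = x)) ∨
      (c s(p, q) = some κ ∧ ¬ (p = y ∧ q = z) ∧ ¬ (p = z ∧ q = y)) := by
  have hun := h.uncoloured
  unfold shift
  by_cases h₁ : s(p, q) = s(x, y)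
  · rw [if_pos h₁, hz, h₁, hun]
    rw [Sym2.eq_iff] at h₁
    grind
  · rw [if_neg h₁]
    by_cases h₂ : s(p, q) = s(y, z)
    · rw [if_pos h₂]
      rw [Sym2.eq_iff] at h₁ h₂
      grind
    · rw [if_neg h₂]
      rw [Sym2.eq_iff] at h₁ h₂
      grind

/-- Moving the colour of `yz` to the uncoloured edge `xy`. -/
lemma ColoursAllBut.colour_shift {x y z : V} {a : ℕ} (h : ColoursAllBut G S c s(x, y))
    (hz : c s(y, z) = some a) (hx : Misses c x a) (had : a ≤ G.degree x + 1) :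
    ColoursAllBut G S (shift c s(x, y) s(y, z)) s(y, z) := by
  have key := h.shift_apply hz
  have hxy : G.Adj x y := h.mem_edgeSet
  have hun := h.uncoloured
  have hne : s(y, z) ≠ s(x, y) := by
    intro he
    rw [he, hun] at hz
    simp at hz
  constructor
  · intro p q κ hκ
    rcases (key p q κ).1 hκ with ⟨-, ⟨rfl, rfl⟩ | ⟨rfl, rfl⟩⟩ | ⟨hκ, -⟩
    exacts [hxy, hxy.symm, h.adj hκ]
  · intro p q κ hκ
    rcases (key p q κ).1 hκ with ⟨rfl, -⟩ | ⟨hκ, -⟩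
    exacts [h.pos hz, h.pos hκ]
  · intro p q q' κ hκ hκ'
    have hinj := @h.inj
    have hx' : ∀ w, c s(x, w) ≠ some a := hx
    rw [key] at hκ hκ'
    grind
  · intro p q κ hpq hκ
    rcases (key p q κ).1 hκ with ⟨rfl, ⟨rfl, rfl⟩ | ⟨rfl, rfl⟩⟩ | ⟨hκ, -⟩
    · omega
    · omega
    · exact h.strictlyLocal p q κ hpq hκ
  · exact h.adj hz
  · simp [shift, hne]
  · intro f
    rw [h.mem_iff]
    unfold shift
    by_cases h₁ : f = s(x, y)
    · simp [h₁, hz]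
    · by_cases h₂ : f = s(y, z)
      · simp [h₂, hz, hne]
      · simp [h₁, h₂]

lemma ColoursAllBut.bigIncidences_shift_subset {x y z : V} {a : ℕ}
    (h : ColoursAllBut G S c s(x, y)) (hz : c s(y, z) = some a) (had : a ≤ G.degree x + 1) :
    bigIncidences G (shift c s(x, y) s(y, z)) ⊆ bigIncidences G c := by
  rintro ⟨p, κ⟩ ⟨q, hq, hlt⟩
  dsimp only at hq hlt
  rcases (h.shift_apply hz p q κ).1 hq with ⟨rfl, ⟨rfl, rfl⟩ | ⟨rfl, rfl⟩⟩ | ⟨hκ, -⟩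
  · omega
  · exact ⟨z, hz, hlt⟩
  · exact ⟨q, hκ, hlt⟩

lemma ColoursAllBut.misses_shift {x y z : V} {a : ℕ}
    (h : ColoursAllBut G S c s(x, y)) (hz : c s(y, z) = some a) (hx : Misses c x a) :
    Misses (shift c s(x, y) s(y, z)) z a := by
  intro q hq
  have hinj := @h.inj
  have hx' : ∀ w, c s(x, w) ≠ some a := hx
  have hadj := (h.adj hz).ne
  have hsw : c s(z, y) = some a := by rwa [Sym2.eq_swap]
  rw [h.shift_apply hz] at hq
  grind

/-- Kempe chain argument: walk along the `a`-`b`-chain from `y` until it ends, or until a vertex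
loses a colour exceeding its palette. -/
lemma ColoursAllBut.colourable_of_closed {N : ℕ}
    (ih : ∀ c' e', ColoursAllBut G S c' e' → (bigIncidences G c').ncard < N → Colourable G S)
    (W : Finset V) (c : Sym2 V → Option ℕ) (x y : V) (a b : ℕ)
    (h : ColoursAllBut G S c s(x, y)) (hN : (bigIncidences G c).ncard ≤ N)
    (hxa : Misses c x a) (ha : 1 ≤ a) (had : a ≤ G.degree x + 1)
    (hyb : Misses c y b) (hb : 1 ≤ b) (hbd : b ≤ G.degree y + 1)
    (hy : y ∈ W) (hx : x ∉ W)
    (hW : ∀ p ∈ W, ∀ q, c s(p, q) = some a ∨ c s(p, q) = some b → q ∈ W) :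
    Colourable G S := by
  induction W using Finset.strongInduction generalizing c x y a b with
  | H W ihW =>
  by_cases hya : Misses c y a
  · exact h.colourable_of_misses hxa hya ha had
  obtain ⟨z, hz⟩ := not_misses_iff.1 hya
  have hab : a ≠ b := by
    rintro rfl
    exact hya hyb
  have hsub := h.bigIncidences_shift_subset hz had
  have hza := h.misses_shift hz hxa
  have h' := h.colour_shift hz hxa had
  by_cases hzd : a ≤ G.degree z + 1
  · refine ihW (W.erase y) (Finset.erase_ssubset hy) _ y z b a h'
      ((Set.ncard_le_ncard hsub (bigIncidences_finite c)).trans hN) ?_ hb hbd hza ha hzd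
      (Finset.mem_erase.2 ⟨(h.adj hz).ne', hW y hy z (Or.inl hz)⟩) (by simp) ?_
    · intro q hq
      rcases (h.shift_apply hz y q b).1 hq with ⟨hba, -⟩ | ⟨hq, -⟩
      exacts [hab hba.symm, hyb q hq]
    · intro p hp q hq
      have hinj := @h.inj
      have hyb' : ∀ w, c s(y, w) ≠ some b := hyb
      have hsw : c s(q, p) = c s(p, q) := by rw [Sym2.eq_swap]
      have hW' := hW p (Finset.mem_of_mem_erase hp) q
      rw [h.shift_apply hz, h.shift_apply hz] at hq
      rw [Finset.mem_erase] at hp ⊢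
      grind
  · refine ih _ _ h' (lt_of_lt_of_le (Set.ncard_lt_ncard ⟨hsub, fun hsup => ?_⟩
      (bigIncidences_finite c)) hN)
    obtain ⟨q, hq, -⟩ := hsup (show (z, a) ∈ bigIncidences G c from
      ⟨y, by rwa [Sym2.eq_swap], not_le.1 hzd⟩)
    exact hza q hq

/-- Vizing fan argument: `F` is the set of leaves `w` already visited by the fan centred at `u`,
each with a colouring in which `uw` is the uncoloured edge. -/
lemma ColoursAllBut.colourable_of_fan {N : ℕ}
    (ih : ∀ c' e', ColoursAllBut G S c' e' → (bigIncidences G c').ncard < N → Colourable G S)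
    (u : V) (n : ℕ) (F : Finset V) (hn : Fintype.card V - F.card = n)
    (c : Sym2 V → Option ℕ) (v : V) (ρ : ℕ)
    (h : ColoursAllBut G S c s(v, u)) (hN : (bigIncidences G c).ncard ≤ N) (hv : v ∉ F)
    (hF : ∀ w ∈ F, ∃ c₀, ColoursAllBut G S c₀ s(w, u) ∧ (bigIncidences G c₀).ncard ≤ N ∧
      c₀ s(u, v) = some ρ ∧ (∀ κ, c s(u, w) = some κ → κ ≤ G.degree w + 1) ∧
      (∀ p q, p ≠ u → q ≠ u → c₀ s(p, q) = c s(p, q)) ∧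
      (∀ κ, Misses c u κ → Misses c₀ u κ) ∧ ∀ x, x ∉ F → x ≠ v → c₀ s(u, x) = c s(u, x)) :
    Colourable G S := by
  induction n using Nat.strong_induction_on generalizing F c v ρ with
  | _ n ihn =>
  obtain ⟨α, hαρ, hα, hαd, hvα⟩ := h.exists_misses ρ
  by_cases huα : Misses c u α
  · exact h.colourable_of_misses hvα huα hα hαd
  obtain ⟨w, hw⟩ := not_misses_iff.1 huα
  have hun := h.uncoloured
  have hun' : c s(u, v) = none := by rwa [Sym2.eq_swap]
  have hwv : w ≠ v := by
    rintro rfl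
    simp [hun'] at hw
  have hvu : v ≠ u := G.ne_of_adj h.mem_edgeSet
  by_cases hwF : w ∈ F
  · have huv : ColoursAllBut G S c s(u, v) := by rwa [Sym2.eq_swap]
    obtain ⟨γ, -, hγ, hγd, huγ⟩ := huv.exists_misses 0
    obtain ⟨c₀, h₀, hN₀, hρ₀, hle, hoff, hmiss, -⟩ := hF w hwF
    have hwu : w ≠ u := G.ne_of_adj h₀.mem_edgeSet
    have hwα : ∀ q, q ≠ u → c s(w, q) ≠ some α := fun q hq hc =>
      hq (h.inj hc (by rwa [Sym2.eq_swap]))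
    have hwα₀ : Misses c₀ w α := by
      intro q hq
      by_cases hqu : q = u
      · subst hqu
        simp [h₀.uncoloured] at hq
      · exact hwα q hqu (hoff w q hwu hqu ▸ hq)
    by_cases huα₀ : Misses c₀ u α
    · exact h₀.colourable_of_misses hwα₀ huα₀ hα (hle α hw)
    obtain ⟨z, hz⟩ := not_misses_iff.1 huα₀
    have hzu : z ≠ u := (h₀.adj hz).ne'
    have hzv : z ≠ v := by
      rintro rfl
      exact hαρ (Option.some.inj (hz.symm.trans hρ₀))
    have hzw : z ≠ w := by
      rintro rfl
      rw [Sym2.eq_swap, h₀.uncoloured] at hz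
      simp at hz
    have hzα : ∀ q, q ≠ u → c s(z, q) ≠ some α := fun q hq hc =>
      hq (h₀.inj ((hoff z q hzu hq).trans hc) (by rwa [Sym2.eq_swap]))
    have hinj := @h.inj
    obtain ⟨W, hzW, hvwW, hW⟩ := exists_closed_avoiding Finset.univ
      (fun p q => p ≠ u ∧ q ≠ u ∧ (c s(p, q) = some α ∨ c s(p, q) = some γ))
      (fun _ _ _ => Finset.mem_univ _)
      (fun p q hpq => ⟨hpq.2.1, hpq.1, by rw [Sym2.eq_swap]; exact hpq.2.2⟩)
      (fun p a b d ha hb hd => by grind) z v w hzv hzw hwv.symm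
      (fun a b ha hb => by grind)
      (fun a b ha hb => by have := hvα a; have := hvα b; grind)
      (fun a b ha hb => by grind)
    by_cases hwW : w ∈ W
    · refine colourable_of_closed ih (W.erase u) c₀ u w γ α (by rwa [Sym2.eq_swap]) hN₀
        (hmiss γ huγ) hγ hγd hwα₀ hα (hle α hw) (Finset.mem_erase.2 ⟨hwu, hwW⟩) (by simp) ?_
      intro p hp q hq
      rw [Finset.mem_erase] at hp ⊢
      have huγ₀ := hmiss γ huγ p
      have hinj₀ := @h₀.inj u z p α hz
      have hsw : c₀ s(u, p) = c₀ s(p, u) := by rw [Sym2.eq_swap]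
      have hoff' := hoff p q hp.1
      have hW' := hW p hp.2 q
      grind
    · refine colourable_of_closed ih (W.erase u) c u v γ α huv hN
        huγ hγ hγd hvα hα hαd (Finset.mem_erase.2 ⟨hvu, hvwW.resolve_right hwW⟩) (by simp) ?_
      intro p hp q hq
      rw [Finset.mem_erase] at hp ⊢
      have huγ' := huγ p
      have hinj' := @h.inj u w p α hw
      have hsw : c s(u, p) = c s(p, u) := by rw [Sym2.eq_swap]
      have hW' := hW p hp.2 q
      grind
  · have hlt : F.card < Fintype.card V :=
      Finset.card_lt_univ_of_notMem hv
    have h' := h.colour_shift hw hvα hαd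
    have hsub := h.bigIncidences_shift_subset hw hαd
    have hmiss : ∀ κ, Misses (shift c s(v, u) s(u, w)) u κ → Misses c u κ := by
      intro κ hκ q hq
      have h₁ := hκ q
      have h₂ := hκ v
      rw [ne_eq, h.shift_apply hw] at h₁ h₂
      grind
    have hstar : ∀ x, x ≠ v → x ≠ w →
        shift c s(v, u) s(u, w) s(u, x) = c s(u, x) := by
      intro x hxv hxw
      ext κ
      rw [h.shift_apply hw]
      grind
    have hoff : ∀ p q, p ≠ u → q ≠ u →
        shift c s(v, u) s(u, w) s(p, q) = c s(p, q) := by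
      intro p q hp hq
      ext κ
      rw [h.shift_apply hw]
      grind
    refine ihn _ ?_ (insert v F) rfl _ w α
      (by rw [@Sym2.eq_swap _ w u]; exact h')
      ((Set.ncard_le_ncard hsub (bigIncidences_finite c)).trans hN) (by simp [hwv, hwF]) ?_
    · rw [Finset.card_insert_of_notMem hv]
      omega
    intro x hx
    rcases Finset.mem_insert.1 hx with rfl | hx
    · refine ⟨c, h, hN, hw, fun κ hκ => ?_, fun p q hp hq => (hoff p q hp hq).symm, hmiss,
        fun y hy hyw => (hstar y (fun hyx => hy (by simp [hyx])) hyw).symm⟩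
      rw [h.shift_apply hw] at hκ
      grind
    · obtain ⟨c₀, h₀, hN₀, -, hle₀, hoff₀, hmiss₀, hstar₀⟩ := hF x hx
      have hxv : x ≠ v := fun hxv => hv (hxv ▸ hx)
      have hxw : x ≠ w := fun hxw => hwF (hxw ▸ hx)
      refine ⟨c₀, h₀, hN₀, (hstar₀ w hwF hwv).trans hw, fun κ hκ => hle₀ κ ?_,
        fun p q hp hq => (hoff₀ p q hp hq).trans (hoff p q hp hq).symm,
        fun κ hκ => hmiss₀ κ (hmiss κ hκ), fun y hy hyw => ?_⟩
      · rwa [hstar x hxv hxw] at hκ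
      · rw [Finset.mem_insert, not_or] at hy
        rw [hstar₀ y hy.2 hy.1, hstar y hy.1 hyw]

lemma ColoursAllBut.colourable {e : Sym2 V} (h : ColoursAllBut G S c e) : Colourable G S := by
  induction hN : (bigIncidences G c).ncard using Nat.strong_induction_on generalizing c e with
  | _ N ih =>
  induction e with | _ v u =>
  exact colourable_of_fan (fun c' e' h' hlt => ih _ hlt h' rfl) u _ ∅ rfl c v 0 h hN.le
    (by simp) (by simp)

end Extension

/-- Any strictly local proper partial edge colouring can be extended to a strictly local
proper partial edge colouring whose coloured edges are exactly the previously coloured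
edges together with one prescribed uncoloured edge `e`. -/
theorem extend_strictly_local (V : Type*) [Fintype V] [DecidableEq V]
    (G : SimpleGraph V) [DecidableRel G.Adj]
    (c : Sym2 V → Option ℕ) (hc : IsProperPartial G c) (hsl : StrictlyLocal G c)
    (e : Sym2 V) (he : e ∈ G.edgeSet) (hun : c e = none) :
    ∃ c' : Sym2 V → Option ℕ, IsProperPartial G c' ∧ StrictlyLocal G c' ∧
      (∀ f, c' f ≠ none ↔ (c f ≠ none ∨ f = e)) := by
  have h : ColoursAllBut G {f | c f ≠ none ∨ f = e} c e :=
    { adj := fun h => (hc.1 _ _ h).1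
      pos := fun h => (hc.1 _ _ h).2
      inj := hc.inj
      strictlyLocal := hsl
      mem_edgeSet := he
      uncoloured := hun
      mem_iff := fun _ => Iff.rfl }
  exact h.colourable
end

section
/- (Vizing's Theorem) Every finite simple graph G with maximum degree Δ admits a proper edge colouring using only colours from {1, …, Δ+1}, i.e., every edge is coloured and any two distinct edges sharing an endpoint receive distinct colours. -/
open SimpleGraph

/-- If all degrees are at most two, a connected component contains at most two vertices of
degree at most one. -/
theorem SimpleGraph.not_reachable_of_degree_le_one {V : Type*} [Fintype V] [DecidableEq V]
    (H : SimpleGraph V) [DecidableRel H.Adj] (h2 : ∀ v, H.degree v ≤ 2) {x y z : V}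
    (hxy : x ≠ y) (hxz : x ≠ z) (hyz : y ≠ z)
    (hx : H.degree x ≤ 1) (hy : H.degree y ≤ 1) (hz : H.degree z ≤ 1)
    (hr : H.Reachable x y) : ¬ H.Reachable x z := by
  classical
  intro hr'
  let s : Set V := {v | H.Reachable x v}
  have hconn : (H.induce s).Connected := by
    have := (H.connectedComponentMk x).connected_toSimpleGraph
    have hs : s = (H.connectedComponentMk x).supp := by
      ext v
      simp [s, ConnectedComponent.mem_supp_iff, reachable_comm]
    rw [hs]
    exact this
  have hcard := hconn.card_vert_le_card_edgeSet_add_one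
  have hsum := (H.induce s).sum_degrees_eq_twice_card_edges
  have hdeg : ∀ v : s, (H.induce s).degree v ≤ H.degree v := by
    intro v
    rw [← card_neighborFinset_eq_degree, ← card_neighborFinset_eq_degree]
    exact Finset.card_le_card_of_injOn Subtype.val (fun w hw => by simpa using hw)
      Subtype.val_injective.injOn
  let T : Finset s := {⟨x, Reachable.refl x⟩, ⟨y, hr⟩, ⟨z, hr'⟩}
  have hT : T.card = 3 := by
    refine Finset.card_eq_three.2 ⟨_, _, _, ?_, ?_, ?_, rfl⟩ <;> simpa
  have hle : ∑ v : s, ((H.induce s).degree v + if v ∈ T then 1 else 0) ≤ ∑ _v : s, 2 := by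
    refine Finset.sum_le_sum fun v _ => ?_
    have h1 := hdeg v
    have h3 := h2 v
    split_ifs with hv
    · have : H.degree v ≤ 1 := by
        simp only [T, Finset.mem_insert, Finset.mem_singleton] at hv
        rcases hv with rfl | rfl | rfl <;> assumption
      omega
    · omega
  rw [Finset.sum_add_distrib, hsum] at hle
  simp only [Finset.sum_ite_mem, Finset.univ_inter, Finset.sum_const, hT, smul_eq_mul,
    Finset.card_univ] at hle
  rw [Nat.card_eq_fintype_card, Nat.card_eq_fintype_card, ← edgeFinset_card] at hcard
  omega

/-- A proper edge colouring of a subgraph of `G`, with colours in `K`. -/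
structure PartialEdgeColoring {V : Type*} (G : SimpleGraph V) (K : Type*) where
  /-- The colour of a pair of vertices, if it is coloured. -/
  color : V → V → Option K
  symm : ∀ u v, color u v = color v u
  adj_of_color : ∀ {u v a}, color u v = some a → G.Adj u v
  proper : ∀ {u v w a}, color u v = some a → color u w = some a → v = w

namespace PartialEdgeColoring

variable {V K : Type*} {G : SimpleGraph V}

/-- No edge at `v` has colour `a`. -/
def Missing (c : PartialEdgeColoring G K) (v : V) (a : K) : Prop :=
  ∀ w, c.color v w ≠ some a

/-- Some colouring colours the pair `x y` and every pair coloured by `c`. -/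
def Augmentable (c : PartialEdgeColoring G K) (x y : V) : Prop :=
  ∃ c' : PartialEdgeColoring G K,
    (∀ u v, c.color u v ≠ none → c'.color u v ≠ none) ∧ c'.color x y ≠ none

theorem exists_missing [Fintype V] [DecidableRel G.Adj] [Fintype K]
    (c : PartialEdgeColoring G K) (v : V) (hv : G.degree v < Fintype.card K) :
    ∃ a, c.Missing v a := by
  classical
  by_contra! h
  simp only [Missing, not_forall, not_not] at h
  choose f hf using h
  refine hv.not_ge ?_
  rw [← card_neighborFinset_eq_degree, ← Finset.card_univ]
  refine Finset.card_le_card_of_injOn f (fun a _ => ?_) fun a _ b _ hab => ?_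
  · simpa using c.adj_of_color (hf a)
  · have := hf b
    rw [← hab, hf a] at this
    exact Option.some.inj this

section Update

variable [DecidableEq V]

/-- Uncolour the edge `x y`. -/
def erase (c : PartialEdgeColoring G K) (x y : V) : PartialEdgeColoring G K where
  color u v := if (u = x ∧ v = y) ∨ (u = y ∧ v = x) then none else c.color u v
  symm u v := by grind [c.symm u v]
  adj_of_color := by grind [c.adj_of_color]
  proper := by grind [c.proper]

/-- Colour the edge `x y` with a colour missing at both ends. -/
def insert (c : PartialEdgeColoring G K) (x y : V) (a : K) (h : G.Adj x y)
    (hx : c.Missing x a) (hy : c.Missing y a) : PartialEdgeColoring G K where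
  color u v := if (u = x ∧ v = y) ∨ (u = y ∧ v = x) then some a else c.color u v
  symm u v := by grind [c.symm u v]
  adj_of_color := by grind [c.adj_of_color, h.symm]
  proper := by
    have := h.ne
    have := @c.proper
    simp only [Missing] at hx hy
    grind

/-- A Vizing fan `y 0, …, y k` at `x`, starting at an uncoloured edge. -/
structure IsFan (c : PartialEdgeColoring G K) (x : V) (y : ℕ → V) (k : ℕ) : Prop where
  adj : G.Adj x (y 0)
  uncolored : c.color x (y 0) = none
  step : ∀ i < k, ∃ b, c.color x (y (i + 1)) = some b ∧ c.Missing (y i) b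
  inj : ∀ i ≤ k, ∀ j ≤ k, y i = y j → i = j

theorem IsFan.augmentable {x : V} {a : K} {k : ℕ} {c : PartialEdgeColoring G K} {y : ℕ → V}
    (hf : c.IsFan x y k) (hx : c.Missing x a) (hy : c.Missing (y k) a) :
    c.Augmentable x (y 0) := by
  induction k generalizing c y with
  | zero => exact ⟨c.insert x (y 0) a hf.adj hx hy, by grind [insert], by grind [insert]⟩
  | succ k ih =>
    obtain ⟨b, hb, hb0⟩ := hf.step 0 (by omega)
    rw [zero_add] at hb
    have hadj := c.adj_of_color hb
    have hne : y 0 ≠ y 1 := fun h => by have := hf.inj 0 (by omega) 1 (by omega) h; omega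
    have hx0 := hf.adj.ne
    have hx1 := hadj.ne
    have hxb : (c.erase x (y 1)).Missing x b := fun w => by
      have := @c.proper x w (y 1) b
      simp only [erase]
      grind
    have hyb : (c.erase x (y 1)).Missing (y 0) b := fun w => by
      have := hb0 w
      simp only [erase]
      grind
    set c' := (c.erase x (y 1)).insert x (y 0) b hf.adj hxb hyb with hc'
    have hcol : ∀ u v, c'.color u v = if (u = x ∧ v = y 0) ∨ (u = y 0 ∧ v = x) then some b
        else if (u = x ∧ v = y 1) ∨ (u = y 1 ∧ v = x) then none else c.color u v :=
      fun u v => rfl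
    have hba : b ≠ a := fun h => hx (y 1) (h ▸ hb)
    have hmiss : ∀ i ≤ k, ∀ d, c.Missing (y (i + 1)) d → c'.Missing (y (i + 1)) d := by
      intro i hi d hd w
      have h0 : y (i + 1) ≠ y 0 := fun h => by
        have := hf.inj (i + 1) (by omega) 0 (by omega) h; omega
      have := hd w
      rw [hcol]
      have hxi : y (i + 1) ≠ x := by
        obtain ⟨e, he, -⟩ := hf.step i (by omega)
        exact (c.adj_of_color he).ne'
      grind
    have hfan : c'.IsFan x (fun i => y (i + 1)) k := by
      refine ⟨hadj, ?_, fun i hi => ?_, fun i hi j hj h => ?_⟩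
      · simp only [hcol, zero_add]
        grind
      · obtain ⟨d, hd, hd'⟩ := hf.step (i + 1) (by omega)
        refine ⟨d, ?_, hmiss i hi.le d hd'⟩
        have h0 : y (i + 1 + 1) ≠ y 0 := fun h => by
          have := hf.inj (i + 1 + 1) (by omega) 0 (by omega) h; omega
        have h1 : y (i + 1 + 1) ≠ y 1 := fun h => by
          have := hf.inj (i + 1 + 1) (by omega) 1 (by omega) h; omega
        rw [hcol]
        grind
      · have := hf.inj (i + 1) (by omega) (j + 1) (by omega) h
        omega
    have hxa : c'.Missing x a := fun w => by
      have := hx w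
      rw [hcol]
      grind
    obtain ⟨c'', h, h'⟩ := ih hfan hxa (hmiss k le_rfl a hy)
    simp only [zero_add] at h'
    have hsymm := c''.symm x (y 1)
    refine ⟨c'', fun u v huv => ?_, h _ _ (by rw [hcol]; simp)⟩
    by_cases h1 : (u = x ∧ v = y 1) ∨ (u = y 1 ∧ v = x)
    · grind
    · apply h
      rw [hcol]
      grind

end Update

section Kempe

/-- The graph of the edges coloured `a` or `b`. -/
def kempe (c : PartialEdgeColoring G K) (a b : K) : SimpleGraph V where
  Adj u v := c.color u v = some a ∨ c.color u v = some b
  symm := ⟨fun u v h => by rwa [c.symm v u]⟩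
  loopless := ⟨fun u h => h.elim (fun h => (c.adj_of_color h).ne rfl)
    fun h => (c.adj_of_color h).ne rfl⟩

theorem degree_kempe_le [Fintype V] (c : PartialEdgeColoring G K) (a b : K)
    [DecidableRel (c.kempe a b).Adj] (v : V) (s : Finset (Option K))
    (hs : ∀ w, (c.kempe a b).Adj v w → c.color v w ∈ s) : (c.kempe a b).degree v ≤ s.card := by
  rw [← card_neighborFinset_eq_degree]
  refine Finset.card_le_card_of_injOn (c.color v) (fun w hw => hs w (by simpa using hw)) ?_
  intro w hw w' hw' h
  rw [Finset.mem_coe, mem_neighborFinset] at hw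
  rcases hw with hw | hw <;> exact c.proper hw (h ▸ hw)

/-- Two of three vertices, each missing one of `a`, `b`, lie in different Kempe chains. -/
theorem kempe_not_reachable [Finite V] (c : PartialEdgeColoring G K) {a b : K} {x y z : V}
    (hxy : x ≠ y) (hxz : x ≠ z) (hyz : y ≠ z)
    (hx : c.Missing x a) (hy : c.Missing y b) (hz : c.Missing z b)
    (h : (c.kempe a b).Reachable x y) : ¬ (c.kempe a b).Reachable x z := by
  classical
  have := Fintype.ofFinite V
  refine (c.kempe a b).not_reachable_of_degree_le_one (fun v => ?_) hxy hxz hyz ?_ ?_ ?_ h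
  · exact (c.degree_kempe_le a b v {some a, some b} (by simp [kempe])).trans Finset.card_le_two
  · exact c.degree_kempe_le a b x {some b} fun w hw => by simpa [kempe, hx w] using hw
  · exact c.degree_kempe_le a b y {some a} fun w hw => by simpa [kempe, hy w] using hw
  · exact c.degree_kempe_le a b z {some a} fun w hw => by simpa [kempe, hz w] using hw

/-- Exchange the colours `a` and `b` on the Kempe chain of `s`. -/
theorem exists_kempe_swap (c : PartialEdgeColoring G K) (a b : K) (s : V) :
    ∃ c' : PartialEdgeColoring G K,
      (∀ u v, c'.color u v = none ↔ c.color u v = none) ∧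
      (∀ u, ¬ (c.kempe a b).Reachable s u → ∀ v, c'.color u v = c.color u v) ∧
      (∀ u v d, d ≠ a → d ≠ b → (c'.color u v = some d ↔ c.color u v = some d)) ∧
      (∀ v, c'.color s v = some a ↔ c.color s v = some b) := by
  classical
  let S : V → Prop := (c.kempe a b).Reachable s
  have hS : ∀ u v, c.color u v = some a ∨ c.color u v = some b → (S u ↔ S v) := fun u v h =>
    ⟨fun hu => hu.trans (Adj.reachable h), fun hv => hv.trans (Adj.reachable h).symm⟩
  let f : V → V → Option K := fun u v =>
    if S u then (c.color u v).map (Equiv.swap a b) else c.color u v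
  have hf : ∀ u v d, f u v = some d ↔
      c.color u v = some (if S u then Equiv.swap a b d else d) := by
    intro u v d
    simp only [f]
    split_ifs
    · simp only [Option.map_eq_some_iff]
      constructor
      · rintro ⟨e, he, rfl⟩
        simpa using he
      · exact fun h => ⟨_, h, by simp⟩
    · rfl
  refine ⟨⟨f, fun u v => ?_, fun {u v d} h => c.adj_of_color ((hf _ _ _).1 h),
    fun {u v w d} h h' => c.proper ((hf _ _ _).1 h) ((hf _ _ _).1 h')⟩, fun u v => ?_,
    fun u hu v => if_neg hu, fun u v d ha hb => ?_, fun v => ?_⟩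
  · have h1 := hS u v
    have h2 := c.symm u v
    simp only [f]
    rcases hc : c.color u v with _ | d
    · simp [← h2, hc]
    · rw [← h2, hc]
      by_cases hd : d = a ∨ d = b
      · have := h1 (by simpa [hc] using hd)
        simp [this]
      · push Not at hd
        simp [Equiv.swap_apply_of_ne_of_ne hd.1 hd.2]
  · simp only [f]
    split_ifs <;> simp
  · exact (hf u v d).trans (by simp [Equiv.swap_apply_of_ne_of_ne ha hb])
  · exact (hf s v a).trans (by simp [S])

end Kempe

theorem IsFan.mono {c : PartialEdgeColoring G K} {x : V} {y : ℕ → V} {k m : ℕ}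
    (hf : c.IsFan x y k) (h : m ≤ k) : c.IsFan x y m :=
  ⟨hf.adj, hf.uncolored, fun i hi => hf.step i (hi.trans_le h),
    fun i hi j hj => hf.inj i (hi.trans h) j (hj.trans h)⟩

variable [DecidableEq V]

/-- A fan is augmentable if the Kempe chain of its last vertex `y k` avoids `x` and every `y i`
whose successor in the fan is joined to `x` by an edge of colour `b`. -/
theorem IsFan.augmentable_of_not_reachable {c : PartialEdgeColoring G K} {x : V} {y : ℕ → V}
    {k : ℕ} {a b : K} (hf : c.IsFan x y k) (hx : c.Missing x a) (hy : c.Missing (y k) b)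
    (hr : ¬ (c.kempe a b).Reachable (y k) x)
    (hstep : ∀ i < k, c.color x (y (i + 1)) = some b → ¬ (c.kempe a b).Reachable (y k) (y i)) :
    c.Augmentable x (y 0) := by
  obtain ⟨c', hnone, hout, hother, hs⟩ := c.exists_kempe_swap a b (y k)
  have hfan : c'.IsFan x y k := by
    refine ⟨hf.adj, (hnone _ _).2 hf.uncolored, fun i hi => ?_, hf.inj⟩
    obtain ⟨d, hd, hd'⟩ := hf.step i hi
    refine ⟨d, (hout x hr _).trans hd, fun w => ?_⟩
    by_cases hdb : d = b
    · subst hdb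
      rw [hout _ (hstep i hi hd)]
      exact hd' w
    · have hda : d ≠ a := fun h => hx _ (h ▸ hd)
      exact fun h => hd' w ((hother _ _ _ hda hdb).1 h)
  obtain ⟨c'', h, h'⟩ := hfan.augmentable (a := a) (fun w => by rw [hout x hr]; exact hx w)
    (fun w h => hy w ((hs w).1 h))
  exact ⟨c'', fun u v huv => h u v (mt (hnone u v).1 huv), h'⟩

theorem IsFan.augmentable_or_extend [Finite V] {c : PartialEdgeColoring G K} {x : V} {y : ℕ → V}
    {k : ℕ} (hmiss : ∀ v, ∃ a, c.Missing v a) (hf : c.IsFan x y k) :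
    c.Augmentable x (y 0) ∨ ∃ y', y' 0 = y 0 ∧ c.IsFan x y' (k + 1) := by
  obtain ⟨a, ha⟩ := hmiss x
  obtain ⟨b, hb⟩ := hmiss (y k)
  by_cases hbx : c.Missing x b
  · exact .inl (hf.augmentable hbx hb)
  simp only [Missing, not_forall, not_not] at hbx
  obtain ⟨z, hz⟩ := hbx
  by_cases hzy : ∃ j ≤ k, y j = z
  · left
    obtain ⟨j, hj, rfl⟩ := hzy
    obtain _ | j := j
    · rw [hf.uncolored] at hz
      cases hz
    obtain ⟨d, hd, hd'⟩ := hf.step j (by omega)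
    obtain rfl : b = d := Option.some.inj (hz.symm.trans hd)
    have huniq : ∀ i < k, c.color x (y (i + 1)) = some b → i = j := fun i hi h => by
      have := hf.inj (i + 1) (by omega) (j + 1) hj (c.proper h hz)
      omega
    have hxy : ∀ i ≤ k, x ≠ y i := by
      rintro (_ | i) hi
      · exact hf.adj.ne
      · obtain ⟨e, he, -⟩ := hf.step i (by omega)
        exact (c.adj_of_color he).ne
    have hjk : y j ≠ y k := fun h => by
      have := hf.inj j (by omega) k le_rfl h
      omega
    by_cases hr : (c.kempe a b).Reachable x (y j)
    · have hr' := c.kempe_not_reachable (hxy j (by omega)) (hxy k le_rfl) hjk ha hd' hb hr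
      refine hf.augmentable_of_not_reachable ha hb (fun h => hr' h.symm) fun i hi h h' => ?_
      rw [huniq i hi h] at h'
      exact hr' (hr.trans h'.symm)
    · refine (hf.mono (by omega : j ≤ k)).augmentable_of_not_reachable ha hd'
        (fun h => hr h.symm) fun i hi h => ?_
      have := huniq i (by omega) h
      omega
  · right
    push Not at hzy
    refine ⟨fun i => if i ≤ k then y i else z, by simp, by simpa using hf.adj,
      by simpa using hf.uncolored, fun i hi => ?_, fun i hi j hj h => ?_⟩
    · by_cases hik : i < k
      · simpa [hik.le, Nat.succ_le_of_lt hik] using hf.step i hik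
      · obtain rfl : i = k := by omega
        exact ⟨b, by simpa using hz, by simpa using hb⟩
    · have := hf.inj i
      grind

theorem augmentable [Fintype V] [DecidableRel G.Adj] [Fintype K] (c : PartialEdgeColoring G K)
    (hK : G.maxDegree < Fintype.card K) {x y : V} (h : G.Adj x y) : c.Augmentable x y := by
  by_cases hc : c.color x y = none
  swap
  · exact ⟨c, fun _ _ => id, hc⟩
  by_contra hn
  have hfans : ∀ k, ∃ f : ℕ → V, f 0 = y ∧ c.IsFan x f k := by
    intro k
    induction k with
    | zero => exact ⟨fun _ => y, rfl, h, hc, by simp, by simp⟩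
    | succ k ih =>
      obtain ⟨f, rfl, hf⟩ := ih
      exact (hf.augmentable_or_extend fun v =>
        c.exists_missing v ((G.degree_le_maxDegree v).trans_lt hK)).resolve_left hn
  obtain ⟨f, -, hf⟩ := hfans (Fintype.card V)
  have := Fintype.card_le_of_injective (fun i : Fin (Fintype.card V + 1) => f i) fun i j hij =>
    Fin.ext (hf.inj i (by omega) j (by omega) hij)
  simp at this

theorem exists_total [Fintype V] [DecidableRel G.Adj] [Fintype K]
    (hK : G.maxDegree < Fintype.card K) :
    ∃ c : PartialEdgeColoring G K, ∀ u v, G.Adj u v → c.color u v ≠ none := by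
  suffices H : ∀ s : Finset (V × V), ∃ c : PartialEdgeColoring G K,
      ∀ p ∈ s, G.Adj p.1 p.2 → c.color p.1 p.2 ≠ none by
    obtain ⟨c, hc⟩ := H Finset.univ
    exact ⟨c, fun u v => hc (u, v) (Finset.mem_univ _)⟩
  intro s
  induction s using Finset.induction_on with
  | empty => exact ⟨⟨fun _ _ => none, by simp, by simp, by simp⟩, by simp⟩
  | insert p s _ ih =>
    obtain ⟨c, hc⟩ := ih
    by_cases hp : G.Adj p.1 p.2
    · obtain ⟨c', h, h'⟩ := c.augmentable hK hp
      exact ⟨c', by grind⟩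
    · exact ⟨c, by grind⟩

end PartialEdgeColoring

/-- **Vizing's Theorem.** Every finite simple graph of maximum degree `Δ` admits a proper
edge colouring using only colours from `{1, …, Δ + 1}`. -/
theorem vizing_theorem (V : Type*) [Fintype V] [DecidableEq V]
    (G : SimpleGraph V) [DecidableRel G.Adj] :
    ∃ c : Sym2 V → ℕ,
      (∀ e₁ ∈ G.edgeSet, ∀ e₂ ∈ G.edgeSet, e₁ ≠ e₂ →
        (∃ z, z ∈ e₁ ∧ z ∈ e₂) → c e₁ ≠ c e₂) ∧
      ∀ e ∈ G.edgeSet, 1 ≤ c e ∧ c e ≤ G.maxDegree + 1 := by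
  obtain ⟨c, hc⟩ := PartialEdgeColoring.exists_total (G := G) (K := Fin (G.maxDegree + 1))
    (by simp)
  refine ⟨Sym2.lift ⟨fun u v => (c.color u v).elim 0 fun a => a + 1,
    fun u v => by simp only [c.symm u v]⟩, ?_, ?_⟩
  · rintro e₁ he₁ e₂ he₂ hne ⟨z, ⟨u, rfl⟩, ⟨v, rfl⟩⟩ heq
    obtain ⟨a, ha⟩ := Option.ne_none_iff_exists'.1 (hc z u he₁)
    obtain ⟨b, hb⟩ := Option.ne_none_iff_exists'.1 (hc z v he₂)
    simp only [Sym2.lift_mk, ha, hb, Option.elim_some, add_left_inj] at heq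
    rw [← Fin.ext heq] at hb
    exact hne (by rw [c.proper ha hb])
  · rintro ⟨u, v⟩ he
    obtain ⟨a, ha⟩ := Option.ne_none_iff_exists'.1 (hc u v he)
    have : Sym2.lift ⟨fun u v => (c.color u v).elim 0 fun a => (a : ℕ) + 1,
      fun u v => by simp only [c.symm u v]⟩ s(u, v) = (a : ℕ) + 1 := by simp [ha]
    change 1 ≤ Sym2.lift _ s(u, v) ∧ Sym2.lift _ s(u, v) ≤ _
    rw [this]
    omega
end

section
/- There is an absolute constant C such that the following holds. Let G be a finite simple graph on n ≥ 2 vertices with maximum degree Δ ≥ 1, let c be a proper partial (Δ+1)-edge colouring of G, and let e be an edge left uncoloured by c. Then there exists an augmenting subgraph for e containing at most C·Δ^7·log n edges. -/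
open SimpleGraph

variable {V : Type*}

/-- A proper partial `(Δ+1)`-edge colouring: a proper partial edge colouring using only
colours from `{1, …, Δ + 1}` where `Δ` is the maximum degree. -/
def IsProperPartialVizing (G : SimpleGraph V) [Fintype V] [DecidableRel G.Adj]
    (c : Sym2 V → Option ℕ) : Prop :=
  IsProperPartial G c ∧ ∀ e κ, c e = some κ → κ ≤ G.maxDegree + 1

namespace VizingChain

/-- No edge at `v` has colour `κ`. -/
def Misses (c : Sym2 V → Option ℕ) (v : V) (κ : ℕ) : Prop :=
  ∀ w, c s(v, w) ≠ some κ

/-- A proper partial edge colouring with colours in `{1, …, D}`, phrased vertex by vertex. -/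
structure IsColouring (G : SimpleGraph V) (D : ℕ) (c : Sym2 V → Option ℕ) : Prop where
  adj : ∀ {a b κ}, c s(a, b) = some κ → G.Adj a b
  bound : ∀ {a b κ}, c s(a, b) = some κ → 1 ≤ κ ∧ κ ≤ D
  inj : ∀ {v a b κ}, c s(v, a) = some κ → c s(v, b) = some κ → a = b

/-- `c'` is obtained from `c` by moving the hole from the edge `e` to the edge `f`, changing
at most `k` edges. -/
structure Reaches (G : SimpleGraph V) (D : ℕ) (c : Sym2 V → Option ℕ) (e : Sym2 V) (k : ℕ)
    (c' : Sym2 V → Option ℕ) (f : Sym2 V) : Prop where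
  col : IsColouring G D c'
  mem : f ∈ G.edgeSet
  unc : c' f = none
  keep : ∀ h, h ≠ f → (c h ≠ none ∨ h = e) → c' h ≠ none
  supp : ∃ S : Finset (Sym2 V), S.card ≤ k ∧ (∀ h ∈ S, h ∈ G.edgeSet) ∧ e ∈ S ∧ f ∈ S ∧
    ∀ h, h ∉ S → c' h = c h

theorem Reaches.mono {G : SimpleGraph V} {D : ℕ} {c c' : Sym2 V → Option ℕ} {e f : Sym2 V}
    {k l : ℕ} (h : Reaches G D c e k c' f) (hkl : k ≤ l) : Reaches G D c e l c' f := by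
  obtain ⟨S, h1, h2⟩ := h.supp
  exact ⟨h.col, h.mem, h.unc, h.keep, S, h1.trans hkl, h2⟩

/-- Colour the edge `ab` with `κ` and uncolour the edge `bb'`. -/
def slide [DecidableEq V] (c : Sym2 V → Option ℕ) (a b b' : V) (κ : ℕ) : Sym2 V → Option ℕ :=
  fun h => if h = s(b, b') then none else if h = s(a, b) then some κ else c h

theorem Reaches.slide [DecidableEq V] {G : SimpleGraph V} {D : ℕ} {c c' : Sym2 V → Option ℕ}
    {e : Sym2 V} {k κ : ℕ} {a b b' : V} (h : Reaches G D c e k c' s(a, b))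
    (ha : Misses c' a κ) (hb : c' s(b, b') = some κ) :
    Reaches G D c e (k + 1) (slide c' a b b' κ) s(b, b') := by
  have hadj : G.Adj a b := h.mem
  have hadj' : G.Adj b b' := h.col.adj hb
  have hne : s(b, b') ≠ s(a, b) := by
    intro h'
    have := h.unc
    rw [← h', hb] at this
    simp at this
  have old : ∀ {f κ'}, VizingChain.slide c' a b b' κ f = some κ' →
      (f = s(a, b) ∧ κ' = κ) ∨ (c' f = some κ' ∧ f ≠ s(b, b')) := by
    intro f κ' hf
    unfold VizingChain.slide at hf
    split_ifs at hf with h1 h2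
    · exact Or.inl ⟨h2, by simpa using hf.symm⟩
    · exact Or.inr ⟨hf, h1⟩
  have clash : ∀ {v p q}, s(v, p) = s(a, b) → c' s(v, q) = some κ → s(v, q) ≠ s(b, b') →
      False := by
    intro v p q h1 h2 h3
    rcases Sym2.eq_iff.1 h1 with ⟨rfl, rfl⟩ | ⟨rfl, rfl⟩
    · exact ha _ h2
    · exact h3 (by rw [h.col.inj h2 hb])
  refine ⟨⟨?_, ?_, ?_⟩, hadj', by simp [VizingChain.slide], ?_, ?_⟩
  · intro p q κ' hc
    rcases old hc with ⟨h1, -⟩ | ⟨h1, -⟩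
    · have := h.mem
      rw [← h1] at this
      exact this
    · exact h.col.adj h1
  · intro p q κ' hc
    rcases old hc with ⟨-, rfl⟩ | ⟨h1, -⟩
    · exact h.col.bound hb
    · exact h.col.bound h1
  · intro v p q κ' hp hq
    rcases old hp with ⟨h1, h1'⟩ | ⟨h1, h1'⟩ <;> rcases old hq with ⟨h2, h2'⟩ | ⟨h2, h2'⟩
    · exact Sym2.congr_right.1 (h1.trans h2.symm)
    · subst h1'
      exact (clash h1 h2 h2').elim
    · subst h2'
      exact (clash h2 h1 h1').elim
    · exact h.col.inj h1 h2
  · intro f hf hc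
    unfold VizingChain.slide
    rw [if_neg hf]
    split_ifs with h1
    · simp
    · exact h.keep f h1 hc
  · obtain ⟨S, h1, h2, h3, h4, h5⟩ := h.supp
    refine ⟨insert s(b, b') S, (Finset.card_insert_le _ _).trans (by omega), ?_, ?_, ?_, ?_⟩
    · intro f hf
      rcases Finset.mem_insert.1 hf with rfl | hf
      · exact hadj'
      · exact h2 f hf
    · exact Finset.mem_insert_of_mem h3
    · exact Finset.mem_insert_self _ _
    · intro f hf
      rw [Finset.mem_insert, not_or] at hf
      have : f ≠ s(a, b) := fun h' => hf.2 (h' ▸ h4)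
      simp [VizingChain.slide, hf.1, this, h5 f hf.2]

/-- A colouring that also colours `e`, keeps all coloured edges coloured and changes at most
`k` edges. -/
def Augments (G : SimpleGraph V) (D : ℕ) (c : Sym2 V → Option ℕ) (e : Sym2 V) (k : ℕ) : Prop :=
  ∃ c', IsColouring G D c' ∧ c' e ≠ none ∧ (∀ h, c h ≠ none → c' h ≠ none) ∧
    ∃ S : Finset (Sym2 V), S.card ≤ k ∧ (∀ h ∈ S, h ∈ G.edgeSet) ∧ e ∈ S ∧
      ∀ h, h ∉ S → c' h = c h

theorem Reaches.augments [DecidableEq V] {G : SimpleGraph V} {D : ℕ}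
    {c c' : Sym2 V → Option ℕ} {e : Sym2 V} {k κ : ℕ} {a b : V}
    (h : Reaches G D c e k c' s(a, b)) (hpos : 1 ≤ κ) (hD : κ ≤ D)
    (ha : Misses c' a κ) (hb : Misses c' b κ) : Augments G D c e k := by
  have old : ∀ {f κ'}, Function.update c' s(a, b) (some κ) f = some κ' →
      (f = s(a, b) ∧ κ' = κ) ∨ c' f = some κ' := by
    intro f κ' hf
    by_cases hh : f = s(a, b)
    · subst hh
      simp at hf
      exact Or.inl ⟨rfl, hf.symm⟩
    · rw [Function.update_of_ne hh] at hf
      exact Or.inr hf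
  have clash : ∀ {v p q}, s(v, p) = s(a, b) → c' s(v, q) = some κ → False := by
    intro v p q h1 h2
    rcases Sym2.eq_iff.1 h1 with ⟨rfl, rfl⟩ | ⟨rfl, rfl⟩
    · exact ha _ h2
    · exact hb _ h2
  have some_of : ∀ f, (f ≠ s(a, b) → c' f ≠ none) →
      Function.update c' s(a, b) (some κ) f ≠ none := by
    intro f hf
    by_cases hh : f = s(a, b)
    · subst hh
      simp
    · rw [Function.update_of_ne hh]
      exact hf hh
  obtain ⟨S, hS1, hS2, hS3, hS4, hS5⟩ := h.supp
  refine ⟨Function.update c' s(a, b) (some κ), ⟨?_, ?_, ?_⟩, ?_, ?_, S, hS1, hS2, hS3, ?_⟩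
  · intro p q κ' hc
    rcases old hc with ⟨h1, -⟩ | h1
    · have := h.mem
      rw [← h1] at this
      exact this
    · exact h.col.adj h1
  · intro p q κ' hc
    rcases old hc with ⟨-, rfl⟩ | h1
    · exact ⟨hpos, hD⟩
    · exact h.col.bound h1
  · intro v p q κ' hp hq
    rcases old hp with ⟨h1, h1'⟩ | h1 <;> rcases old hq with ⟨h2, h2'⟩ | h2
    · exact Sym2.congr_right.1 (h1.trans h2.symm)
    · subst h1'
      exact (clash h1 h2).elim
    · subst h2'
      exact (clash h2 h1).elim
    · exact h.col.inj h1 h2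
  · exact some_of e fun hh => h.keep e hh (Or.inr rfl)
  · exact fun f hf => some_of f fun hh => h.keep f hh (Or.inl hf)
  · intro f hf
    have : f ≠ s(a, b) := fun h' => hf (h' ▸ hS4)
    rw [Function.update_of_ne this, hS5 f hf]

/-- The colours `γ, η, γ, η, …`. -/
def alt (γ η i : ℕ) : ℕ := if i % 2 = 0 then γ else η

theorem alt_ne {γ η : ℕ} (h : γ ≠ η) (i : ℕ) : alt γ η i ≠ alt γ η (i + 1) := by
  unfold alt
  split_ifs <;> omega

theorem alt_add_two (γ η i : ℕ) : alt γ η (i + 2) = alt γ η i := by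
  simp [alt]

theorem alt_eq_or (γ η i : ℕ) : alt γ η i = γ ∨ alt γ η i = η := by
  unfold alt
  split_ifs <;> simp

theorem alt_congr (γ η : ℕ) {i j : ℕ} (h : i % 2 = j % 2) : alt γ η i = alt γ η j := by
  simp [alt, h]

theorem alt_mem_pair (γ η i j : ℕ) : alt γ η i = alt γ η j ∨ alt γ η i = alt γ η (j + 1) := by
  rcases Nat.mod_two_eq_zero_or_one (i + j) with h | h
  · exact Or.inl (alt_congr _ _ (by omega))
  · exact Or.inr (alt_congr _ _ (by omega))

/-- The first `r` edges of the sequence `s` are coloured alternately `γ, η, γ, …`. -/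
def IsKempe (c : Sym2 V → Option ℕ) (γ η : ℕ) (s : ℕ → V) (r : ℕ) : Prop :=
  ∀ j < r, c s(s j, s (j + 1)) = some (alt γ η j)

theorem IsKempe.mono {c : Sym2 V → Option ℕ} {γ η : ℕ} {s : ℕ → V} {r r' : ℕ}
    (h : IsKempe c γ η s r) (hr : r' ≤ r) : IsKempe c γ η s r' :=
  fun j hj => h j (hj.trans_le hr)

theorem IsKempe.start_unique {G : SimpleGraph V} {D : ℕ} {c : Sym2 V → Option ℕ}
    (hc : IsColouring G D c) {γ η : ℕ} {s s' : ℕ → V} (h0 : Misses c (s 0) η)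
    (h0' : Misses c (s' 0) η) :
    ∀ {r r' : ℕ}, IsKempe c γ η s r → IsKempe c γ η s' r' → s r = s' r' → r % 2 = r' % 2 →
      r = r' ∧ s 0 = s' 0 := by
  have key : ∀ {t t' : ℕ → V} {r : ℕ}, Misses c (t 0) η → IsKempe c γ η t' (r + 1) →
      t 0 = t' (r + 1) → (r + 1) % 2 = 0 → False := by
    intro t t' r ht ht' heq hpar
    have := ht' r (Nat.lt_succ_self r)
    rw [← heq, Sym2.eq_swap, alt, if_neg (by omega)] at this
    exact ht _ this
  intro r
  induction r with
  | zero =>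
    intro r' _ h2 heq hpar
    cases r' with
    | zero => exact ⟨rfl, heq⟩
    | succ r' => exact (key h0 h2 heq (by omega)).elim
  | succ r ih =>
    intro r' h1 h2 heq hpar
    cases r' with
    | zero => exact (key h0' h1 heq.symm (by omega)).elim
    | succ r' =>
      have e1 := h1 r (Nat.lt_succ_self r)
      have e2 := h2 r' (Nat.lt_succ_self r')
      rw [Sym2.eq_swap] at e1 e2
      rw [← heq, alt_congr γ η (show r' % 2 = r % 2 by omega)] at e2
      have := ih (h1.mono (Nat.le_succ r)) (h2.mono (Nat.le_succ r')) (hc.inj e1 e2) (by omega)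
      exact ⟨by omega, this.2⟩

theorem IsKempe.ne_of_odd {G : SimpleGraph V} {D : ℕ} {c : Sym2 V → Option ℕ}
    (hc : IsColouring G D c) {γ η : ℕ} {s : ℕ → V} {r : ℕ} (h : IsKempe c γ η s r) :
    ∀ {d i : ℕ}, i + 2 * d + 1 ≤ r → s i ≠ s (i + 2 * d + 1) := by
  intro d
  induction d with
  | zero => exact fun {i} hi => (hc.adj (h i (by omega))).ne
  | succ d ih =>
    intro i hi heq
    have e1 := h i (by omega)
    have e2 := h (i + 2 * d + 2) (by omega)
    rw [Sym2.eq_swap, show i + 2 * d + 2 + 1 = i + 2 * (d + 1) + 1 by ring, ← heq,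
      alt_congr γ η (show (i + 2 * d + 2) % 2 = i % 2 by omega)] at e2
    refine ih (i := i + 1) (by omega) ((hc.inj e1 e2).trans ?_)
    congr 1
    ring

theorem IsKempe.injective {G : SimpleGraph V} {D : ℕ} {c : Sym2 V → Option ℕ}
    (hc : IsColouring G D c) {γ η : ℕ} {s : ℕ → V} {r : ℕ} (h0 : Misses c (s 0) η)
    (h : IsKempe c γ η s r) {i j : ℕ} (hij : i < j) (hj : j ≤ r) : s i ≠ s j := by
  intro heq
  rcases Nat.mod_two_eq_zero_or_one (j - i) with hp | hp
  · have := (IsKempe.start_unique hc h0 h0 (h.mono (hij.le.trans hj)) (h.mono hj) heq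
      (by omega)).1
    omega
  · have e : j = i + 2 * ((j - i) / 2) + 1 := by omega
    rw [e] at heq hj
    exact h.ne_of_odd hc hj heq

/-- Rotating a fan: the hole moves from `x (y 0)` to `x (y m)`. -/
theorem Reaches.fan [DecidableEq V] {G : SimpleGraph V} {D : ℕ} {c c' : Sym2 V → Option ℕ}
    {e : Sym2 V} {k : ℕ} {x : V} {y : ℕ → V} {col : ℕ → ℕ}
    (h : Reaches G D c e k c' s(x, y 0)) :
    ∀ m : ℕ, (∀ i < m, c' s(x, y (i + 1)) = some (col i)) → (∀ i < m, Misses c' (y i) (col i)) →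
      (∀ i j, i < j → j ≤ m → y i ≠ y j) →
      ∃ c'', Reaches G D c e (k + m) c'' s(x, y m) ∧ (∀ h, x ∉ h → c'' h = c' h) ∧
        (∀ κ, Misses c' x κ → Misses c'' x κ) ∧
        (∀ v, (∀ i ≤ m, v ≠ y i) → c'' s(x, v) = c' s(x, v)) ∧
        ∀ v κ, c'' s(x, v) = some κ → c' s(x, v) = some κ ∨ ∃ i < m, v = y i ∧ κ = col i := by
  intro m
  induction m with
  | zero => exact fun _ _ _ => ⟨c', h, fun _ _ => rfl, fun _ hκ => hκ, fun _ _ => rfl,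
    fun _ _ hκ => Or.inl hκ⟩
  | succ m ih =>
    intro h1 h2 h3
    obtain ⟨d, r1, r2, r3, r4, r5⟩ := ih (fun i hi => h1 i (by omega))
      (fun i hi => h2 i (by omega))
      (fun i j hij hj => h3 i j hij (by omega))
    have hxy : x ≠ y m := (show G.Adj x (y m) from r1.mem).ne
    have hcol : d s(x, y (m + 1)) = some (col m) := by
      rw [r4 _ fun i hi => (h3 i (m + 1) (by omega) le_rfl).symm]
      exact h1 m (Nat.lt_succ_self m)
    have hmiss : Misses d (y m) (col m) := by
      intro w hw
      by_cases hwx : w = x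
      · subst hwx
        rw [Sym2.eq_swap, r1.unc] at hw
        simp at hw
      · rw [r2 _ (by simp [hxy, Ne.symm hwx])] at hw
        exact h2 m (Nat.lt_succ_self m) w hw
    rw [Sym2.eq_swap] at r1
    refine ⟨VizingChain.slide d (y m) x (y (m + 1)) (col m), r1.slide hmiss hcol, ?_, ?_, ?_, ?_⟩
    · intro f hf
      have n1 : f ≠ s(x, y (m + 1)) := by
        rintro rfl
        simp at hf
      have n2 : f ≠ s(y m, x) := by
        rintro rfl
        simp at hf
      simp [VizingChain.slide, n1, n2, r2 f hf]
    · intro κ hκ w hw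
      unfold VizingChain.slide at hw
      split_ifs at hw
      · rw [Option.some_inj] at hw
        subst hw
        exact r3 _ hκ _ hcol
      · exact r3 _ hκ _ hw
    · intro v hv
      have n1 : s(x, v) ≠ s(x, y (m + 1)) := fun hh =>
        hv (m + 1) le_rfl (Sym2.congr_right.1 hh)
      have n2 : s(x, v) ≠ s(y m, x) := fun hh =>
        hv m (by omega) (Sym2.congr_right.1 (hh.trans Sym2.eq_swap))
      simp only [VizingChain.slide, n1, n2, if_false]
      exact r4 v fun i hi => hv i (by omega)
    · intro v κ hv
      unfold VizingChain.slide at hv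
      split_ifs at hv with q1 q2
      · exact Or.inr ⟨m, Nat.lt_succ_self m, Sym2.congr_right.1 (q2.trans Sym2.eq_swap),
          (Option.some_inj.1 hv).symm⟩
      · rcases r5 v κ hv with hv | ⟨i, hi, hv⟩
        · exact Or.inl hv
        · exact Or.inr ⟨i, by omega, hv⟩

/-- Shifting along a path whose edges are coloured alternately. -/
theorem Reaches.path [DecidableEq V] {G : SimpleGraph V} {D : ℕ} {c c' : Sym2 V → Option ℕ}
    {e : Sym2 V} {k γ η : ℕ} {p : ℕ → V} (h : Reaches G D c e k c' s(p 0, p 1))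
    (hγ : Misses c' (p 0) γ) (hη : Misses c' (p 1) η) (hne : γ ≠ η) :
    ∀ m : ℕ, (∀ i < m, c' s(p (i + 1), p (i + 2)) = some (alt γ η i)) →
      (∀ i j, i < j → j ≤ m + 1 → p i ≠ p j) →
      ∃ c'', Reaches G D c e (k + m) c'' s(p m, p (m + 1)) ∧ Misses c'' (p m) (alt γ η m) ∧
        Misses c'' (p (m + 1)) (alt γ η (m + 1)) ∧
        (∀ h, (∀ j ≤ m, h ≠ s(p j, p (j + 1))) → c'' h = c' h) ∧
        ∀ j < m, c'' s(p j, p (j + 1)) = some (alt γ η j) := by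
  intro m
  induction m with
  | zero =>
    exact fun _ _ => ⟨c', h, by simpa [alt] using hγ, by simpa [alt] using hη,
      fun _ _ => rfl, by simp⟩
  | succ m ih =>
    intro h1 h2
    obtain ⟨d, r1, r2, r3, r4, r5⟩ := ih (fun i hi => h1 i (by omega))
      (fun i j hij hj => h2 i j hij (by omega))
    have edge_ne : ∀ i j, i < j → j ≤ m + 1 → s(p j, p (j + 1)) ≠ s(p i, p (i + 1)) := by
      intro i j hij hj hh
      rcases Sym2.eq_iff.1 hh with ⟨q, -⟩ | ⟨-, q⟩
      · exact h2 i j hij (by omega) q.symm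
      · exact h2 i (j + 1) (by omega) (by omega) q.symm
    have hcol : d s(p (m + 1), p (m + 2)) = some (alt γ η m) := by
      rw [r4 _ fun j hj => edge_ne j (m + 1) (by omega) le_rfl]
      exact h1 m (Nat.lt_succ_self m)
    have hn := alt_ne hne m
    refine ⟨VizingChain.slide d (p m) (p (m + 1)) (p (m + 2)) (alt γ η m), r1.slide r2 hcol,
      ?_, ?_, ?_, ?_⟩
    · intro w hw
      unfold VizingChain.slide at hw
      split_ifs at hw
      · exact hn (Option.some_inj.1 hw)
      · exact r3 w hw
    · intro w hw
      rw [alt_add_two] at hw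
      unfold VizingChain.slide at hw
      split_ifs at hw with q1 q2
      · rcases Sym2.eq_iff.1 q2 with ⟨q, -⟩ | ⟨q, -⟩
        · exact h2 m (m + 2) (by omega) le_rfl q.symm
        · exact h2 (m + 1) (m + 2) (by omega) le_rfl q.symm
      · rw [Sym2.eq_swap] at hcol
        have := r1.col.inj hw hcol
        rw [this, Sym2.eq_swap] at q1
        exact q1 rfl
    · intro f hf
      simp only [VizingChain.slide, hf (m + 1) le_rfl, hf m (by omega), if_false]
      exact r4 f fun j hj => hf j (by omega)
    · intro j hj
      have n1 : s(p j, p (j + 1)) ≠ s(p (m + 1), p (m + 2)) :=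
        (edge_ne j (m + 1) hj le_rfl).symm
      rcases Nat.lt_succ_iff_lt_or_eq.1 hj with hj' | rfl
      · have n2 : s(p j, p (j + 1)) ≠ s(p m, p (m + 1)) := (edge_ne j m hj' (by omega)).symm
        simp only [VizingChain.slide, n1, n2, if_false]
        exact r5 j hj'
      · simp [VizingChain.slide, n1]

/-- The other end of the `κ`-coloured edge at `v`, or `v` itself if there is none. -/
noncomputable def partner (c : Sym2 V → Option ℕ) (v : V) (κ : ℕ) : V :=
  open Classical in if h : ∃ w, c s(v, w) = some κ then h.choose else v

theorem partner_spec {c : Sym2 V → Option ℕ} {v : V} {κ : ℕ} (h : ¬ Misses c v κ) :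
    c s(v, partner c v κ) = some κ := by
  have h' : ∃ w, c s(v, w) = some κ := by
    unfold Misses at h
    push Not at h
    exact h
  unfold partner
  rw [dif_pos h']
  exact h'.choose_spec

/-- A maximal fan whose leaves choose the colours `μ`, stopped at the first colour that is `α`
or has been chosen before. -/
theorem Reaches.exists_fan [DecidableEq V] {G : SimpleGraph V} {D : ℕ}
    {c c' : Sym2 V → Option ℕ} {e : Sym2 V} {k K α : ℕ} {x y : V} {μ : V → ℕ}
    (h : Reaches G D c e k c' s(x, y)) (haug : ¬ Augments G D c e K) (hk : k + D ≤ K)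
    (hμ : ∀ v, 1 ≤ μ v ∧ μ v ≤ D) (hmiss : ∀ v, G.Adj x v → Misses c' v (μ v)) :
    ∃ (f : ℕ → V) (m : ℕ), m ≤ D ∧ f 0 = y ∧
      (∀ i < m, c' s(x, f (i + 1)) = some (μ (f i))) ∧ (∀ i ≤ m, G.Adj x (f i)) ∧
      (∀ i j, i < j → j ≤ m → f i ≠ f j) ∧ (∀ i ≤ m, ¬ Misses c' x (μ (f i))) ∧
      (∀ i < m, μ (f i) ≠ α) ∧ (∀ i j, i < j → j < m → μ (f i) ≠ μ (f j)) ∧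
      (μ (f m) = α ∨ ∃ j < m, μ (f j) = μ (f m)) := by
  classical
  let f : ℕ → V := fun i => Nat.rec y (fun _ v => partner c' x (μ v)) i
  have f0 : f 0 = y := rfl
  have fs : ∀ i, f (i + 1) = partner c' x (μ (f i)) := fun _ => rfl
  clear_value f
  have hex : ∃ m, m ≤ D ∧ (μ (f m) = α ∨ ∃ j < m, μ (f j) = μ (f m)) := by
    obtain ⟨i, hi, j, hj, hij, heq⟩ := Finset.exists_ne_map_eq_of_card_lt_of_maps_to
      (s := Finset.range (D + 1)) (t := Finset.Icc 1 D) (f := fun i => μ (f i)) (by simp)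
      (fun i _ => Finset.mem_coe.2 (Finset.mem_Icc.2 (hμ _)))
    simp only [Finset.mem_range] at hi hj
    rcases lt_or_gt_of_ne hij with hlt | hlt
    · exact ⟨j, by omega, Or.inr ⟨i, hlt, heq⟩⟩
    · exact ⟨i, by omega, Or.inr ⟨j, hlt, heq.symm⟩⟩
  obtain ⟨hmD, hm⟩ := Nat.find_spec hex
  have hmin : ∀ i < Nat.find hex, ¬ (μ (f i) = α ∨ ∃ j < i, μ (f j) = μ (f i)) :=
    fun i hi hh => Nat.find_min hex hi ⟨by omega, hh⟩
  generalize Nat.find hex = m at hmD hm hmin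
  have distinct : ∀ n ≤ m, (∀ i < n, c' s(x, f (i + 1)) = some (μ (f i))) →
      ∀ i j, i < j → j ≤ n → f i ≠ f j := by
    intro n hn hcol i j hij hj heq
    obtain ⟨j, rfl⟩ : ∃ j', j = j' + 1 := ⟨j - 1, by omega⟩
    have e1 := hcol j (by omega)
    rw [← heq] at e1
    cases i with
    | zero =>
      rw [f0, h.unc] at e1
      simp at e1
    | succ i =>
      rw [hcol i (by omega), Option.some_inj] at e1
      exact hmin j (by omega) (Or.inr ⟨i, by omega, e1⟩)
  have adj : ∀ n, (∀ i < n, c' s(x, f (i + 1)) = some (μ (f i))) → ∀ i ≤ n, G.Adj x (f i) := by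
    intro n hcol i hi
    cases i with
    | zero => exact f0 ▸ h.mem
    | succ i => exact h.col.adj (hcol i (by omega))
  have present : ∀ n ≤ m, (∀ i < n, c' s(x, f (i + 1)) = some (μ (f i))) →
      ¬ Misses c' x (μ (f n)) := by
    intro n hn hcol hx
    have h' := h
    rw [← f0] at h'
    obtain ⟨d, r1, r2, r3, -⟩ := h'.fan (col := fun i => μ (f i)) n hcol
      (fun i hi => hmiss _ (adj n hcol i hi.le)) (distinct n hn hcol)
    refine haug ((r1.mono (by omega)).augments (hμ _).1 (hμ _).2 (r3 _ hx) ?_)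
    intro w hw
    by_cases hwx : w = x
    · subst hwx
      rw [Sym2.eq_swap, r1.unc] at hw
      simp at hw
    · rw [r2 _ (by simp [(adj n hcol n le_rfl).ne, Ne.symm hwx])] at hw
      exact hmiss _ (adj n hcol n le_rfl) w hw
  have hcol : ∀ n ≤ m, ∀ i < n, c' s(x, f (i + 1)) = some (μ (f i)) := by
    intro n
    induction n with
    | zero => simp
    | succ n ih =>
      intro hn i hi
      have := ih (by omega)
      rcases Nat.lt_succ_iff_lt_or_eq.1 hi with hi' | rfl
      · exact this i hi'
      · rw [fs]
        exact partner_spec (present _ (by omega) this)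
  exact ⟨f, m, hmD, f0, hcol m le_rfl, adj m (hcol m le_rfl), distinct m le_rfl (hcol m le_rfl),
    fun i hi => present i hi (hcol i hi), fun i hi hh => hmin i hi (Or.inl hh),
    fun i j hij hj hh => hmin j hj (Or.inr ⟨i, hij, hh⟩), hm⟩

/-- `v` lies in the closed neighbourhood of `A`. -/
def Near (G : SimpleGraph V) (A : Finset V) (v : V) : Prop :=
  v ∈ A ∨ ∃ u ∈ A, G.Adj v u

/-- The hole has been moved to an edge `xy`. Away from `A'`, the present colouring `c'` differs
from `c` only along an alternating `α/β`-path with vertex set `X ⊆ A` that ends in `x`. -/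
structure HoleState (G : SimpleGraph V) (D : ℕ) (c : Sym2 V → Option ℕ) (e : Sym2 V) (μ : V → ℕ)
    (k : ℕ) (A' A : Finset V) (x y : V) (c' : Sym2 V → Option ℕ) (α β : ℕ) (X : Set V) :
    Prop where
  reach : Reaches G D c e k c' s(x, y)
  sub : ∀ v ∈ X, v ∈ A
  diff : ∀ a b, c' s(a, b) ≠ c s(a, b) → a ∈ A' ∨ b ∈ A' ∨
    ((a ∈ X ∨ b ∈ X) ∧ (∀ κ, c s(a, b) = some κ → κ = α ∨ κ = β) ∧
      ∀ κ, c' s(a, b) = some κ → κ = α ∨ κ = β)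
  present : ∀ v ∈ X, v ≠ x → ¬ Misses c' v α
  closed : ∀ v ∈ X, ∀ w κ, κ = α ∨ κ = β → c' s(v, w) = some κ → w ∈ X ∨ w ∈ A'
  misses : Misses c' x β
  avoid : ∀ v, v ∈ X ∨ v = x → ¬ Near G A' v → μ v ≠ α ∧ μ v ≠ β
  start : α = 0 ∨ (x ∈ X ∧ 1 ≤ β ∧ β ≤ D)

theorem HoleState.misses_choice {G : SimpleGraph V} {D : ℕ} {c c' : Sym2 V → Option ℕ}
    {e : Sym2 V} {μ : V → ℕ} {k α β : ℕ} {A' A : Finset V} {x y : V} {X : Set V}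
    (h : HoleState G D c e μ k A' A x y c' α β X) (hμ : ∀ v, Misses c v (μ v)) {v : V}
    (hv : ¬ Near G A' v) : Misses c' v (μ v) := by
  intro w hw
  have hadj := h.reach.col.adj hw
  rcases h.diff v w (by rw [hw]; exact (hμ v w).symm) with h1 | h1 | ⟨h1, -, h3⟩
  · exact hv (Or.inl h1)
  · exact hv (Or.inr ⟨w, h1, hadj⟩)
  · have hvX : v ∈ X := by
      rcases h1 with h1 | h1
      · exact h1
      · rw [Sym2.eq_swap] at hw
        rcases h.closed w h1 v _ (h3 _ (by rwa [Sym2.eq_swap])) hw with h4 | h4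
        · exact h4
        · exact (hv (Or.inl h4)).elim
    have := h.avoid v (Or.inl hvX) hv
    have := h3 _ hw
    tauto

/-- A leaf of a fan at `x` to which the hole can be moved, and from which an alternating path
of `c'` starts that avoids `x` and coincides with a path of `c` until it comes near `A'`. -/
theorem HoleState.exists_leaf [DecidableEq V] {G : SimpleGraph V} {D : ℕ}
    {c c' : Sym2 V → Option ℕ} {e : Sym2 V} {μ : V → ℕ} {k K α β : ℕ} {A' A : Finset V}
    {x y : V} {X : Set V} (h : HoleState G D c e μ k A' A x y c' α β X)
    (haug : ¬ Augments G D c e K) (hk : k + D ≤ K) (hμD : ∀ v, 1 ≤ μ v ∧ μ v ≤ D)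
    (hμ : ∀ v, Misses c v (μ v)) (hx : ¬ Near G A' x) (hx' : ∀ v, G.Adj x v → ¬ Near G A' v) :
    ∃ z γ c'', G.Adj x z ∧ Reaches G D c e (k + D) c'' s(x, z) ∧ (∀ h, x ∉ h → c'' h = c' h) ∧
      Misses c'' x γ ∧ γ ≠ μ z ∧ 1 ≤ γ ∧ γ ≤ D ∧
      ∀ (s : ℕ → V) (i : ℕ), s 0 = z → IsKempe c' γ (μ z) s i → (∀ j < i, ¬ Near G A' (s j)) →
        s i ≠ x ∧ IsKempe c γ (μ z) s i ∧
          (c'' s(x, s i) = some (μ z) → c' s(x, s i) = some (μ z)) := by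
  have hmiss : ∀ v, G.Adj x v → Misses c' v (μ v) := fun v hv => h.misses_choice hμ (hx' v hv)
  obtain ⟨f, m, hmD, f0, hcol, hadj, hinj, hpres, hα, hμf, hend⟩ :=
    h.reach.exists_fan haug hk hμD hmiss (α := α)
  have hr := h.reach
  rw [← f0] at hr
  have rotate : ∀ n ≤ m, ∀ γ, Misses c' x γ → ∃ c'', Reaches G D c e (k + D) c'' s(x, f n) ∧
      (∀ h, x ∉ h → c'' h = c' h) ∧ Misses c'' x γ ∧
      ∀ v κ, c'' s(x, v) = some κ →
        c' s(x, v) = some κ ∨ ∃ i < n, v = f i ∧ κ = μ (f i) := by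
    intro n hn γ hγ
    obtain ⟨d, r1, r2, r3, -, r5⟩ := hr.fan (col := fun i => μ (f i)) n
      (fun i hi => hcol i (by omega)) (fun i hi => hmiss _ (hadj i (by omega)))
      (fun i j hij hj => hinj i j hij (by omega))
    exact ⟨d, r1.mono (by omega), r2, r3 _ hγ, r5⟩
  have hγη : ∀ n ≤ m, ∀ γ, Misses c' x γ → γ ≠ μ (f n) := fun n hn γ hγ hh =>
    hpres n hn (hh ▸ hγ)
  by_cases hmα : μ (f m) = α
  · have hα0 : α ≠ 0 := by
      have := hμD (f m)
      omega
    obtain ⟨hxX, hβ1, hβD⟩ := h.start.resolve_left hα0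
    obtain ⟨d, r1, r2, r3, r5⟩ := rotate m le_rfl β h.misses
    refine ⟨f m, β, d, hadj m le_rfl, r1, r2, r3, hγη m le_rfl β h.misses, hβ1, hβD, ?_⟩
    intro s i hs0 hs hnear
    have hpair : ∀ j, alt β (μ (f m)) j = α ∨ alt β (μ (f m)) j = β := by
      intro j
      rw [hmα]
      exact (alt_eq_or β α j).symm
    have hX : ∀ j ≤ i, s j ∉ X := by
      intro j
      induction j with
      | zero =>
        intro _ hh
        rw [hs0] at hh
        exact h.present _ hh (hadj m le_rfl).ne' (hmα ▸ hmiss _ (hadj m le_rfl))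
      | succ j ih =>
        intro hj hh
        have e1 := hs j (by omega)
        rw [Sym2.eq_swap] at e1
        rcases h.closed _ hh _ _ (hpair j) e1 with h1 | h1
        · exact ih (by omega) h1
        · exact hnear j (by omega) (Or.inl h1)
    refine ⟨fun hh => hX i le_rfl (hh ▸ hxX), ?_, ?_⟩
    rotate_left
    · intro hv
      rcases r5 _ _ hv with hv | ⟨j, hj, -, hv⟩
      · exact hv
      · exact (hα j hj (hv ▸ hmα)).elim
    intro j hj
    by_contra hne
    rcases h.diff _ _ (fun hh => hne (hh ▸ hs j hj)) with h1 | h1 | ⟨h1, -⟩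
    · exact hnear j hj (Or.inl h1)
    · exact hnear j hj (Or.inr ⟨_, h1, h.reach.col.adj (hs j hj)⟩)
    · rcases h1 with h1 | h1
      · exact hX j hj.le h1
      · exact hX (j + 1) hj h1
  · obtain ⟨j₀, hj₀, heq⟩ := hend.resolve_left hmα
    have hγ : Misses c' x (μ x) := h.misses_choice hμ hx
    have hxαβ := h.avoid x (Or.inr rfl) hx
    have original : ∀ n ≤ m, μ (f n) ≠ α → ∀ (s : ℕ → V) (i : ℕ), IsKempe c' (μ x) (μ (f n)) s i →
        (∀ j < i, ¬ Near G A' (s j)) → IsKempe c (μ x) (μ (f n)) s i := by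
      intro n hn hnα s i hs hnear j hj
      by_contra hne
      rcases h.diff _ _ (fun hh => hne (hh ▸ hs j hj)) with h1 | h1 | ⟨-, -, h1⟩
      · exact hnear j hj (Or.inl h1)
      · exact hnear j hj (Or.inr ⟨_, h1, h.reach.col.adj (hs j hj)⟩)
      · have hnβ : μ (f n) ≠ β := fun hh => hpres n hn (hh ▸ h.misses)
        have := h1 _ (hs j hj)
        rcases alt_eq_or (μ x) (μ (f n)) j with h2 | h2 <;> rw [h2] at this <;> tauto
    have even_of : ∀ n ≤ m, ∀ (s : ℕ → V) (i : ℕ), s 0 = f n → IsKempe c' (μ x) (μ (f n)) s i →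
        s i = x → i % 2 = 0 := by
      intro n hn s i hs0 hs hi
      by_contra hodd
      obtain ⟨i, rfl⟩ : ∃ i', i = i' + 1 := ⟨i - 1, by omega⟩
      have := hs i (Nat.lt_succ_self i)
      rw [hi, Sym2.eq_swap, alt, if_pos (by omega)] at this
      exact hγ _ this
    obtain ⟨n, hn, hnα, havoid⟩ : ∃ n ≤ m, μ (f n) ≠ α ∧ ∀ (s : ℕ → V) (i : ℕ), s 0 = f n →
        IsKempe c' (μ x) (μ (f n)) s i → s i ≠ x ∧ ∀ j < n, μ (f j) = μ (f n) → s i ≠ f j := by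
      by_cases hbad : ∃ (s : ℕ → V) (i : ℕ), s 0 = f m ∧ IsKempe c' (μ x) (μ (f m)) s i ∧
          (s i = x ∨ s i = f j₀)
      · obtain ⟨s, i, hs0, hs, hi⟩ := hbad
        refine ⟨j₀, hj₀.le, hα j₀ hj₀, fun t l ht0 ht =>
          ⟨fun hl => ?_, fun j hj hh => (hμf j j₀ hj hj₀ hh).elim⟩⟩
        have ht_even := even_of j₀ hj₀.le t l ht0 ht hl
        have hmiss_s : Misses c' (s 0) (μ (f m)) := by
          rw [hs0]
          exact hmiss _ (hadj m le_rfl)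
        have hmiss_t : Misses c' (t 0) (μ (f m)) := by
          rw [ht0, ← heq]
          exact hmiss _ (hadj j₀ hj₀.le)
        rw [heq] at ht
        have hdistinct : s 0 ≠ t 0 := by
          rw [hs0, ht0]
          exact (hinj j₀ m hj₀ le_rfl).symm
        rcases hi with hi | hi
        · have hs_even := even_of m le_rfl s i hs0 hs hi
          exact hdistinct (IsKempe.start_unique h.reach.col hmiss_s hmiss_t hs ht
            (hi.trans hl.symm) (by omega)).2
        · have hi_pos : i ≠ 0 := by
            rintro rfl
            exact hdistinct (hi.trans ht0.symm)
          have hodd : i % 2 = 1 := by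
            by_contra heven
            exact hdistinct (IsKempe.start_unique h.reach.col hmiss_s hmiss_t hs
              (ht.mono (Nat.zero_le l)) (hi.trans ht0.symm) (by omega)).2
          have hrev : ∀ a, a ≤ i → a ≤ l → t a = s (i - a) := by
            intro a
            induction a with
            | zero => exact fun _ _ => ht0.trans hi.symm
            | succ a ih =>
              intro ha hl
              have e1 := ht a (by omega)
              have e2 := hs (i - (a + 1)) (by omega)
              rw [show i - (a + 1) + 1 = i - a by omega, ← ih (by omega) (by omega),
                Sym2.eq_swap, alt_congr _ _ (show (i - (a + 1)) % 2 = a % 2 by omega)] at e2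
              exact h.reach.col.inj e1 e2
          rcases le_or_gt l i with hli | hli
          · have := even_of m le_rfl s (i - l) hs0 (hs.mono (by omega))
              ((hrev l hli le_rfl).symm.trans hl)
            omega
          · have e1 := ht i hli
            rw [hrev i le_rfl hli.le, Nat.sub_self, alt, if_neg (by omega)] at e1
            exact hmiss_s _ e1
      · refine ⟨m, le_rfl, hmα, fun s i hs0 hs =>
          ⟨fun hi => hbad ⟨s, i, hs0, hs, Or.inl hi⟩, fun j hj hh hi => ?_⟩⟩
        have : j = j₀ := by
          rcases lt_trichotomy j j₀ with q | q | q
          · exact (hμf j j₀ q hj₀ (hh.trans heq.symm)).elim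
          · exact q
          · exact (hμf j₀ j q hj (heq.trans hh.symm)).elim
        exact hbad ⟨s, i, hs0, hs, Or.inr (this ▸ hi)⟩
    obtain ⟨d, r1, r2, r3, r5⟩ := rotate n hn _ hγ
    refine ⟨f n, μ x, d, hadj n hn, r1, r2, r3, hγη n hn _ hγ, (hμD x).1, (hμD x).2,
      fun s i hs0 hs hnear => ⟨(havoid s i hs0 hs).1, original n hn hnα s i hs hnear, ?_⟩⟩
    intro hv
    rcases r5 _ _ hv with hv | ⟨j, hj, hsj, hv⟩
    · exact hv
    · exact ((havoid s i hs0 hs).2 j hj hv.symm hsj).elim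

/-- `v` is reached from a neighbour of `x` by an alternating path of `c`, one of whose colours is
chosen by that neighbour. -/
def Touches (G : SimpleGraph V) (D : ℕ) (c : Sym2 V → Option ℕ) (μ : V → ℕ) (x v : V) : Prop :=
  ∃ (γ : ℕ) (s : ℕ → V) (i : ℕ), G.Adj x (s 0) ∧ 1 ≤ γ ∧ γ ≤ D ∧
    IsKempe c γ (μ (s 0)) s i ∧ s i = v

/-- Unless an alternating path starting next to `x` comes near `A'`, the hole can be moved along
it to `l` different vertices. -/
theorem HoleState.extend [DecidableEq V] {G : SimpleGraph V} {D : ℕ}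
    {c c' : Sym2 V → Option ℕ} {e : Sym2 V} {μ : V → ℕ} {k K l α β : ℕ} {A' A : Finset V}
    {x y : V} {X : Set V} (h : HoleState G D c e μ k A' A x y c' α β X)
    (haug : ¬ Augments G D c e K) (hk : k + D + l ≤ K) (hμD : ∀ v, 1 ≤ μ v ∧ μ v ≤ D)
    (hμ : ∀ v, Misses c v (μ v)) (hA : A' ⊆ A) (hxA : x ∈ A)
    (hx : ¬ Near G A' x) (hfar : ∀ v, Near G A' v → ¬ Touches G D c μ x v) :
    ∃ s : ℕ → V, (∀ i < l, Touches G D c μ x (s i)) ∧ (∀ i j, i < j → j < l → s i ≠ s j) ∧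
      ∀ (B : Finset V), (∀ i < l, s i ∈ B) → ∀ t < l,
        ∃ y' d α' β' X', HoleState G D c e μ (k + D + l) A B (s t) y' d α' β' X' := by
  have hx' : ∀ v, G.Adj x v → ¬ Near G A' v := fun v hv hn =>
    hfar v hn ⟨1, fun _ => v, 0, hv, le_rfl, (hμD v).1.trans (hμD v).2,
      fun _ hj => (Nat.not_lt_zero _ hj).elim, rfl⟩
  obtain ⟨z, γ, c₁, hxz, r1, r2, r3, hγη, hγ1, hγD, hpath⟩ :=
    h.exists_leaf haug (by omega) hμD hμ hx hx'
  obtain ⟨s, s0, sn⟩ : ∃ s : ℕ → V, s 0 = z ∧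
      ∀ n, s (n + 1) = partner c' (s n) (alt γ (μ z) n) :=
    ⟨fun n => Nat.rec z (fun n v => partner c' v (alt γ (μ z) n)) n, rfl, fun _ => rfl⟩
  have hzmiss : Misses c' (s 0) (μ z) := by
    rw [s0]
    exact h.misses_choice hμ (hx' z hxz)
  have hz₁ : Misses c₁ (s 0) (μ z) := by
    intro w hw
    by_cases hwx : w = x
    · subst hwx
      rw [s0, Sym2.eq_swap, r1.unc] at hw
      simp at hw
    · rw [r2 _ (by simp [s0, hxz.ne, Ne.symm hwx])] at hw
      exact hzmiss w hw
  have hfar' : ∀ i, IsKempe c γ (μ z) s i → ¬ Near G A' (s i) := fun i hi hn =>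
    hfar _ hn ⟨γ, s, i, s0 ▸ hxz, hγ1, hγD, s0 ▸ hi, rfl⟩
  let p : ℕ → V := fun n => Nat.casesOn n x s
  have p0 : p 0 = x := rfl
  have ps : ∀ n, p (n + 1) = s n := fun _ => rfl
  clear_value p
  have moves : ∀ i, IsKempe c' γ (μ z) s i → (∀ j ≤ i, s j ≠ x) →
      (∀ i' j, i' < j → j ≤ i + 1 → p i' ≠ p j) ∧
      ∃ c₂, Reaches G D c e (k + D + i) c₂ s(p i, p (i + 1)) ∧
        Misses c₂ (p i) (alt γ (μ z) i) ∧ Misses c₂ (p (i + 1)) (alt γ (μ z) (i + 1)) ∧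
        (∀ h, (∀ j ≤ i, h ≠ s(p j, p (j + 1))) → c₂ h = c₁ h) ∧
        ∀ j < i, c₂ s(p j, p (j + 1)) = some (alt γ (μ z) j) := by
    intro i hi hix
    have hinj : ∀ i' j, i' < j → j ≤ i + 1 → p i' ≠ p j := by
      intro i' j hij hj
      obtain ⟨j, rfl⟩ : ∃ j', j = j' + 1 := ⟨j - 1, by omega⟩
      rw [ps]
      cases i' with
      | zero =>
        rw [p0]
        exact (hix j (by omega)).symm
      | succ i' =>
        rw [ps]
        exact hi.injective h.reach.col hzmiss (by omega) (by omega)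
    refine ⟨hinj, ?_⟩
    refine Reaches.path (c' := c₁) (p := p) ?_ ?_ ?_ hγη i ?_ hinj
    · rw [p0, ps, s0]
      exact r1
    · rw [p0]
      exact r3
    · rw [ps]
      exact hz₁
    · intro j hj
      rw [ps, ps, r2 _ (by simp [(hix j hj.le).symm, (hix (j + 1) hj).symm])]
      exact hi j hj
  have hkempe : ∀ i ≤ l, IsKempe c' γ (μ z) s i ∧ IsKempe c γ (μ z) s i ∧ ∀ j ≤ i, s j ≠ x := by
    intro i
    induction i with
    | zero =>
      intro _
      refine ⟨fun _ hj => (Nat.not_lt_zero _ hj).elim, fun _ hj => (Nat.not_lt_zero _ hj).elim, ?_⟩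
      intro j hj
      rw [Nat.le_zero.1 hj, s0]
      exact hxz.ne'
    | succ i ih =>
      intro hi
      obtain ⟨k1, k2, k3⟩ := ih (by omega)
      have hstep : c' s(s i, s (i + 1)) = some (alt γ (μ z) i) := by
        rw [sn]
        refine partner_spec fun hm => ?_
        obtain ⟨hinj, c₂, m1, m2, m3, m4, m5⟩ := moves i k1 k3
        have hb : 1 ≤ alt γ (μ z) i ∧ alt γ (μ z) i ≤ D := by
          rcases alt_eq_or γ (μ z) i with hh | hh <;> rw [hh]
          · exact ⟨hγ1, hγD⟩
          · exact hμD z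
        refine haug ((m1.mono (by omega)).augments hb.1 hb.2 m2 ?_)
        intro w hw
        rw [ps] at hw
        by_cases hwi : s(s i, w) = s(p i, p (i + 1))
        · rw [hwi, m1.unc] at hw
          simp at hw
        · rw [m4 _ ?_] at hw
          · by_cases hwx : w = x
            · subst hwx
              rw [Sym2.eq_swap] at hw
              rcases alt_eq_or γ (μ z) i with hh | hh
              · rw [hh] at hw
                exact r3 _ hw
              · rw [hh] at hw hm
                have := (hpath s i s0 k1 fun j hj => hfar' j (k2.mono hj.le)).2.2 hw
                rw [Sym2.eq_swap] at this
                exact hm _ this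
            · rw [r2 _ (by simp [(k3 i le_rfl).symm, Ne.symm hwx])] at hw
              exact hm w hw
          · intro j hj hh
            rcases Nat.lt_or_eq_of_le hj with hj | rfl
            · rw [ps] at hh
              have : s i = p j ∨ s i = s j := by
                have := Sym2.mem_mk_left (s i) w
                rw [hh] at this
                exact Sym2.mem_iff.1 this
              rw [← ps i, ← ps j] at this
              rcases this with q | q
              · exact hinj j (i + 1) (by omega) le_rfl q.symm
              · exact hinj (j + 1) (i + 1) (by omega) le_rfl q.symm
            · rw [ps] at hwi hh
              exact hwi hh
      have k1' : IsKempe c' γ (μ z) s (i + 1) := by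
        intro j hj
        rcases Nat.lt_succ_iff_lt_or_eq.1 hj with hj | rfl
        · exact k1 j hj
        · exact hstep
      obtain ⟨q1, q2, -⟩ := hpath s (i + 1) s0 k1' fun j hj => hfar' j (k2.mono (by omega))
      refine ⟨k1', q2, fun j hj => ?_⟩
      rcases Nat.lt_or_eq_of_le hj with hj | rfl
      · exact k3 j (by omega)
      · exact q1
  obtain ⟨k1, k2, k3⟩ := hkempe l le_rfl
  refine ⟨s, fun i hi => ⟨γ, s, i, s0 ▸ hxz, hγ1, hγD, s0 ▸ k2.mono hi.le, rfl⟩,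
    fun i j hij hj => k1.injective h.reach.col hzmiss hij hj.le, fun B hB t ht => ?_⟩
  obtain ⟨hinj, c₂, m1, m2, m3, m4, m5⟩ := moves (t + 1) (k1.mono ht) fun j hj => k3 j (by omega)
  have hpair : ∀ j, alt γ (μ z) j = alt γ (μ z) t ∨ alt γ (μ z) j = alt γ (μ z) (t + 1) :=
    fun j => alt_mem_pair γ (μ z) j t
  have hreach : Reaches G D c e (k + D + l) c₂ s(s t, s (t + 1)) := by
    have := m1.mono (show k + D + (t + 1) ≤ k + D + l by omega)
    rwa [ps, ps] at this
  have hmiss_t : Misses c₂ (s t) (alt γ (μ z) (t + 1)) := ps t ▸ m2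
  refine ⟨s (t + 1), c₂, alt γ (μ z) t, alt γ (μ z) (t + 1), {v | ∃ j ≤ t, v = s j},
    hreach, ?_, ?_, ?_, ?_, hmiss_t, ?_, ?_⟩
  · rintro v ⟨j, hj, rfl⟩
    exact hB j (by omega)
  · intro a b hab
    have endpoint : ∀ {q}, q ∈ s(a, b) → a = q ∨ b = q := fun hq =>
      (Sym2.mem_iff.1 hq).imp Eq.symm Eq.symm
    by_cases hp : ∃ j ≤ t + 1, s(a, b) = s(p j, p (j + 1))
    · obtain ⟨j, hj, hp⟩ := hp
      cases j with
      | zero =>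
        have : x ∈ s(a, b) := by
          rw [hp, p0]
          exact Sym2.mem_mk_left _ _
        rcases endpoint this with rfl | rfl
        · exact Or.inl hxA
        · exact Or.inr (Or.inl hxA)
      | succ j =>
        refine Or.inr (Or.inr ⟨?_, ?_, ?_⟩)
        · have : s j ∈ s(a, b) := by
            rw [hp, ps]
            exact Sym2.mem_mk_left _ _
          rcases endpoint this with rfl | rfl
          · exact Or.inl ⟨j, by omega, rfl⟩
          · exact Or.inr ⟨j, by omega, rfl⟩
        · intro κ hκ
          rw [hp, ps, ps, k2 j (by omega), Option.some_inj] at hκ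
          exact hκ ▸ hpair j
        · intro κ hκ
          rw [hp] at hκ
          rcases Nat.lt_or_eq_of_le hj with hj | hj
          · rw [m5 _ hj, Option.some_inj] at hκ
            exact hκ ▸ hpair (j + 1)
          · rw [hj, m1.unc] at hκ
            simp at hκ
    · push Not at hp
      rw [m4 _ hp] at hab
      by_cases hx_mem : x ∈ s(a, b)
      · rcases endpoint hx_mem with rfl | rfl
        · exact Or.inl hxA
        · exact Or.inr (Or.inl hxA)
      · rw [r2 _ hx_mem] at hab
        rcases h.diff a b hab with q | q | ⟨q | q, -⟩
        · exact Or.inl (hA q)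
        · exact Or.inr (Or.inl (hA q))
        · exact Or.inl (h.sub a q)
        · exact Or.inr (Or.inl (h.sub b q))
  · rintro v ⟨j, hj, rfl⟩ hne hmiss
    have hjt : j < t := lt_of_le_of_ne hj fun hh => hne (by rw [hh])
    have e1 := m5 j (by omega)
    have e2 := m5 (j + 1) (by omega)
    rw [ps] at e1
    rw [ps, ps] at e2
    rw [Sym2.eq_swap] at e1
    rcases alt_mem_pair γ (μ z) t j with q | q
    · exact hmiss _ (q ▸ e1)
    · exact hmiss _ (q ▸ e2)
  · rintro v ⟨j, hj, rfl⟩ w κ hκ hw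
    have e1 := m5 j (by omega)
    rw [ps, Sym2.eq_swap] at e1
    have hκj : κ = alt γ (μ z) j ∨ κ = alt γ (μ z) (j + 1) := by
      rcases hκ with rfl | rfl
      · exact alt_mem_pair γ (μ z) t j
      · exact alt_mem_pair γ (μ z) (t + 1) j
    rcases hκj with rfl | rfl
    · rw [m1.col.inj hw e1]
      cases j with
      | zero => exact Or.inr (p0 ▸ hxA)
      | succ j => exact Or.inl ⟨j, by omega, ps j⟩
    · rcases Nat.lt_or_eq_of_le hj with hj | rfl
      · have e2 := m5 (j + 1) (by omega)
        rw [ps, ps] at e2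
        rw [m1.col.inj hw e2]
        exact Or.inl ⟨j + 1, by omega, rfl⟩
      · exact (hmiss_t w hw).elim
  · intro v hv hnear
    obtain ⟨j, hj, rfl⟩ : ∃ j ≤ t, v = s j := by
      rcases hv with hv | hv
      · exact hv
      · exact ⟨t, le_rfl, by rw [hv]⟩
    cases j with
    | zero => exact (hnear (Or.inr ⟨x, hxA, s0 ▸ hxz.symm⟩)).elim
    | succ j =>
      have e1 := k2 j (by omega)
      have e2 := k2 (j + 1) (by omega)
      rw [Sym2.eq_swap] at e1
      have hne : ∀ i, μ (s (j + 1)) ≠ alt γ (μ z) i := by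
        intro i hh
        rcases alt_mem_pair γ (μ z) i j with q | q
        · exact hμ _ _ (by rw [hh, q]; exact e1)
        · exact hμ _ _ (by rw [hh, q]; exact e2)
      exact ⟨hne t, hne (t + 1)⟩
  · refine Or.inr ⟨⟨t, le_rfl, rfl⟩, ?_⟩
    rcases alt_eq_or γ (μ z) (t + 1) with hh | hh <;> rw [hh]
    · exact ⟨hγ1, hγD⟩
    · exact hμD z

/-- Few vertices have a neighbour from which an alternating path reaches `v`. -/
theorem card_touches_le [Fintype V] {G : SimpleGraph V} [DecidableRel G.Adj] {D : ℕ}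
    {c : Sym2 V → Option ℕ} {μ : V → ℕ} (hD : ∀ v, G.degree v ≤ D) (hc : IsColouring G D c)
    (hμD : ∀ v, 1 ≤ μ v ∧ μ v ≤ D) (hμ : ∀ v, Misses c v (μ v)) (v : V) (T : Finset V)
    (hT : ∀ x ∈ T, Touches G D c μ x v) : T.card ≤ 2 * D ^ 3 := by
  classical
  let I := Finset.Icc 1 D ×ˢ Finset.Icc 1 D ×ˢ Finset.range 2
  let F : ℕ × ℕ × ℕ → Finset V := fun p => T.filter fun x => ∃ (s : ℕ → V) (i : ℕ),
    G.Adj x (s 0) ∧ IsKempe c p.1 p.2.1 s i ∧ μ (s 0) = p.2.1 ∧ s i = v ∧ i % 2 = p.2.2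
  have hcover : T ⊆ I.biUnion F := by
    intro x hx
    obtain ⟨γ, s, i, h1, h2, h3, h4, h5⟩ := hT x hx
    have := hμD (s 0)
    simp only [I, F, Finset.mem_biUnion, Finset.mem_product, Finset.mem_Icc, Finset.mem_range,
      Finset.mem_filter]
    exact ⟨(γ, μ (s 0), i % 2), ⟨⟨h2, h3⟩, this, Nat.mod_lt _ two_pos⟩, hx, s, i, h1, h4, rfl,
      h5, rfl⟩
  have hF : ∀ p ∈ I, (F p).card ≤ D := by
    intro p _
    rcases (F p).eq_empty_or_nonempty with h | ⟨x, hx⟩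
    · simp [h]
    · obtain ⟨s, i, -, h2, h3, h4, h5⟩ := (Finset.mem_filter.1 hx).2
      refine (Finset.card_le_card fun x' hx' => ?_).trans
        ((G.card_neighborFinset_eq_degree (s 0)).trans_le (hD (s 0)))
      obtain ⟨s', i', k1, k2, k3, k4, k5⟩ := (Finset.mem_filter.1 hx').2
      rw [mem_neighborFinset,
        (IsKempe.start_unique hc (h3 ▸ hμ _) (k3 ▸ hμ _) h2 k2 (h4.trans k4.symm)
          (h5.trans k5.symm)).2]
      exact k1.symm
  refine (Finset.card_le_card hcover).trans ((Finset.card_biUnion_le_card_mul I F D hF).trans ?_)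
  simp only [I, Finset.card_product, Nat.card_Icc, Finset.card_range, Nat.add_sub_cancel]
  exact le_of_eq (by ring)

/-- Few vertices are close to `A'` or have a neighbour from which an alternating path comes
close to `A'`. -/
theorem card_bad_le [Fintype V] {G : SimpleGraph V} [DecidableRel G.Adj] {D : ℕ}
    {c : Sym2 V → Option ℕ} {μ : V → ℕ} (hD : ∀ v, G.degree v + 1 ≤ D) (hc : IsColouring G D c)
    (hμD : ∀ v, 1 ≤ μ v ∧ μ v ≤ D) (hμ : ∀ v, Misses c v (μ v)) (A' T : Finset V)
    (hT : ∀ x ∈ T, Near G A' x ∨ ∃ v, Near G A' v ∧ Touches G D c μ x v) :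
    T.card ≤ 3 * D ^ 4 * A'.card := by
  classical
  let W := A'.biUnion fun u => insert u (G.neighborFinset u)
  have hW : ∀ v, Near G A' v → v ∈ W := by
    intro v hv
    simp only [W, Finset.mem_biUnion, Finset.mem_insert, mem_neighborFinset]
    rcases hv with hv | ⟨u, hu, hv⟩
    · exact ⟨v, hv, Or.inl rfl⟩
    · exact ⟨u, hu, Or.inr hv.symm⟩
  have hWcard : W.card ≤ A'.card * D :=
    Finset.card_biUnion_le_card_mul _ _ _ fun u _ => (Finset.card_insert_le _ _).trans
      ((congrArg (· + 1) (G.card_neighborFinset_eq_degree u)).trans_le (hD u))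
  have hcover : T ⊆ W ∪ W.biUnion fun v => T.filter fun x => Touches G D c μ x v := by
    intro x hx
    rcases hT x hx with h | ⟨v, h1, h2⟩
    · exact Finset.mem_union_left _ (hW x h)
    · refine Finset.mem_union_right _ (Finset.mem_biUnion.2 ⟨v, hW v h1, ?_⟩)
      exact Finset.mem_filter.2 ⟨hx, h2⟩
  have hU : (W.biUnion fun v => T.filter fun x => Touches G D c μ x v).card ≤
      W.card * (2 * D ^ 3) :=
    Finset.card_biUnion_le_card_mul _ _ _ fun v _ =>
      card_touches_le (fun v => (Nat.le_succ _).trans (hD v)) hc hμD hμ v _ fun x hx =>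
        (Finset.mem_filter.1 hx).2
  have h1 := (Finset.card_le_card hcover).trans (Finset.card_union_le _ _)
  rcases W.eq_empty_or_nonempty with hWe | ⟨w, -⟩
  · have : W.card = 0 := by rw [hWe]; rfl
    rw [this] at hU h1
    omega
  · have hDpos : 1 ≤ D := (Nat.le_add_left _ _).trans (hD w)
    calc T.card ≤ W.card * (1 + 2 * D ^ 3) := by linarith
      _ ≤ (A'.card * D) * (3 * D ^ 3) := by
        have := Nat.one_le_pow 3 D hDpos
        gcongr
        omega
      _ = 3 * D ^ 4 * A'.card := by ring

/-- If no small augmentation exists, a hole that can be moved to many places can be moved to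
many more. -/
theorem exists_larger_holes [Fintype V] [DecidableEq V] {G : SimpleGraph V} [DecidableRel G.Adj]
    {D : ℕ} {c : Sym2 V → Option ℕ} {e : Sym2 V} {μ : V → ℕ} {k K : ℕ} {A' A : Finset V}
    (hD : ∀ v, G.degree v + 1 ≤ D) (hc : IsColouring G D c) (hμD : ∀ v, 1 ≤ μ v ∧ μ v ≤ D)
    (hμ : ∀ v, Misses c v (μ v)) (haug : ¬ Augments G D c e K) (hk : k + D + 24 * D ^ 7 ≤ K)
    (hA : A' ⊆ A) (hcard : 6 * D ^ 4 * A'.card ≤ A.card) (hApos : A.Nonempty)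
    (h : ∀ x ∈ A, x ∉ A' → ∃ y c' α β X, HoleState G D c e μ k A' A x y c' α β X) :
    ∃ B : Finset V, A ⊆ B ∧ 6 * D ^ 4 * A.card ≤ B.card ∧
      ∀ x ∈ B, x ∉ A → ∃ y c' α β X,
        HoleState G D c e μ (k + D + 24 * D ^ 7) A B x y c' α β X := by
  classical
  set l := 24 * D ^ 7 with hl
  let Bad : V → Prop := fun x => Near G A' x ∨ ∃ v, Near G A' v ∧ Touches G D c μ x v
  have hbad : (A.filter Bad).card ≤ 3 * D ^ 4 * A'.card :=
    card_bad_le hD hc hμD hμ A' _ fun x hx => (Finset.mem_filter.1 hx).2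
  have hgood : A.card ≤ 2 * (A.filter fun x => ¬ Bad x).card := by
    have := A.card_filter_add_card_filter_not Bad
    have : 6 * D ^ 4 * A'.card = 2 * (3 * D ^ 4 * A'.card) := by ring
    omega
  have hext : ∀ x, ∃ s : ℕ → V, x ∈ A → ¬ Bad x → (∀ i < l, Touches G D c μ x (s i)) ∧
      (∀ i j, i < j → j < l → s i ≠ s j) ∧
      ∀ (B : Finset V), (∀ i < l, s i ∈ B) → ∀ t < l,
        ∃ y' d α' β' X', HoleState G D c e μ (k + D + l) A B (s t) y' d α' β' X' := by
    intro x
    by_cases hx : x ∈ A ∧ ¬ Bad x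
    · obtain ⟨hxA, hxb⟩ := hx
      have hxb' := hxb
      simp only [Bad, not_or, not_exists, not_and] at hxb'
      obtain ⟨y, c', α, β, X, hst⟩ := h x hxA fun hh => hxb'.1 (Or.inl hh)
      obtain ⟨s, hs⟩ := hst.extend haug hk hμD hμ hA hxA hxb'.1 hxb'.2
      exact ⟨s, fun _ _ => hs⟩
    · exact ⟨fun _ => x, fun h1 h2 => (hx ⟨h1, h2⟩).elim⟩
  choose s hs using hext
  let N := (A.filter fun x => ¬ Bad x).biUnion fun x => (Finset.range l).image (s x)
  have hN : ∀ {x}, x ∈ A → ¬ Bad x → ∀ i < l, s x i ∈ N := fun hx hb i hi =>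
    Finset.mem_biUnion.2 ⟨_, Finset.mem_filter.2 ⟨hx, hb⟩,
      Finset.mem_image_of_mem _ (Finset.mem_range.2 hi)⟩
  have hcount : (A.filter fun x => ¬ Bad x).card * l ≤ N.card * (2 * D ^ 3) := by
    refine Finset.card_mul_le_card_mul (Touches G D c μ) (fun x hx => ?_) fun v _ => ?_
    · obtain ⟨hxA, hxb⟩ := Finset.mem_filter.1 hx
      obtain ⟨h1, h2, -⟩ := hs x hxA hxb
      calc l = ((Finset.range l).image (s x)).card := by
            rw [Finset.card_image_of_injOn, Finset.card_range]
            intro i hi j hj hij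
            simp only [Finset.coe_range, Set.mem_Iio] at hi hj
            rcases lt_trichotomy i j with hlt | hlt | hlt
            · exact (h2 i j hlt hj hij).elim
            · exact hlt
            · exact (h2 j i hlt hi hij.symm).elim
        _ ≤ _ := Finset.card_le_card fun v hv => by
            obtain ⟨i, hi, rfl⟩ := Finset.mem_image.1 hv
            rw [Finset.mem_range] at hi
            exact Finset.mem_filter.2 ⟨hN hxA hxb i hi, h1 i hi⟩
    · exact card_touches_le (fun v => (Nat.le_succ _).trans (hD v)) hc hμD hμ v _ fun x hx =>
        (Finset.mem_filter.1 hx).2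
  refine ⟨A ∪ N, Finset.subset_union_left, ?_, ?_⟩
  · have hDpos : 0 < 2 * D ^ 3 := by
      obtain ⟨v, -⟩ := hApos
      have : 0 < D := (hμD v).1.trans (hμD v).2
      positivity
    refine le_trans ?_ (Finset.card_le_card Finset.subset_union_right)
    refine Nat.le_of_mul_le_mul_right ?_ hDpos
    calc 6 * D ^ 4 * A.card * (2 * D ^ 3) = A.card * (12 * D ^ 7) := by ring
      _ ≤ (2 * (A.filter fun x => ¬ Bad x).card) * (12 * D ^ 7) := by gcongr
      _ = (A.filter fun x => ¬ Bad x).card * l := by rw [hl]; ring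
      _ ≤ _ := hcount
  · intro v hv hvA
    obtain ⟨x, hx, hv⟩ := Finset.mem_biUnion.1 ((Finset.mem_union.1 hv).resolve_left hvA)
    obtain ⟨i, hi, rfl⟩ := Finset.mem_image.1 hv
    obtain ⟨hxA, hxb⟩ := Finset.mem_filter.1 hx
    exact (hs x hxA hxb).2.2 _ (fun j hj => Finset.mem_union_right _ (hN hxA hxb j hj)) i
      (Finset.mem_range.1 hi)

/-- If no small augmentation exists, the hole can be moved to exponentially many places. -/
theorem exists_many_holes [Fintype V] [DecidableEq V] {G : SimpleGraph V} [DecidableRel G.Adj]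
    {D : ℕ} {c : Sym2 V → Option ℕ} {e : Sym2 V} {μ : V → ℕ} {K : ℕ}
    (hD : ∀ v, G.degree v + 1 ≤ D) (hc : IsColouring G D c) (hμD : ∀ v, 1 ≤ μ v ∧ μ v ≤ D)
    (hμ : ∀ v, Misses c v (μ v)) (he : e ∈ G.edgeSet) (hunc : c e = none)
    (haug : ¬ Augments G D c e K) (i : ℕ) (hi : 1 + i * (D + 24 * D ^ 7) ≤ K) :
    ∃ A' A : Finset V, A' ⊆ A ∧ 6 * D ^ 4 * A'.card ≤ A.card ∧ (6 * D ^ 4) ^ i ≤ A.card ∧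
      ∀ x ∈ A, x ∉ A' → ∃ y c' α β X,
        HoleState G D c e μ (1 + i * (D + 24 * D ^ 7)) A' A x y c' α β X := by
  have hDpos : 0 < D := by
    induction e with
    | _ x y => exact (hμD x).1.trans (hμD x).2
  induction i with
  | zero =>
    induction e with
    | _ x y =>
      refine ⟨∅, {x}, Finset.empty_subset _, by simp, by simp, fun x' hx' _ => ?_⟩
      obtain rfl := Finset.mem_singleton.1 hx'
      refine ⟨y, c, 0, 0, ∅, ⟨hc, he, hunc, ?_, {s(x', y)}, by simp, ?_, by simp, by simp,
        fun _ _ => rfl⟩, by simp, by simp, by simp, by simp, fun w hw => ?_, fun v _ _ => ?_,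
        Or.inl rfl⟩
      · rintro h h1 (h2 | h2)
        · exact h2
        · exact (h1 h2).elim
      · simpa using he
      · exact absurd (hc.bound hw).1 (by omega)
      · have := (hμD v).1
        omega
  | succ i ih =>
    have hstep : 1 + (i + 1) * (D + 24 * D ^ 7) = 1 + i * (D + 24 * D ^ 7) + D + 24 * D ^ 7 := by
      ring
    obtain ⟨A', A, h1, h2, h3, h4⟩ := ih (by omega)
    have hApos : A.Nonempty := Finset.card_pos.1 (lt_of_lt_of_le (by positivity) h3)
    obtain ⟨B, k1, k2, k3⟩ :=
      exists_larger_holes hD hc hμD hμ haug (hstep ▸ hi) h1 h2 hApos h4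
    refine ⟨A, B, k1, k2, ?_, hstep ▸ k3⟩
    calc (6 * D ^ 4) ^ (i + 1) = 6 * D ^ 4 * (6 * D ^ 4) ^ i := by ring
      _ ≤ 6 * D ^ 4 * A.card := by gcongr
      _ ≤ B.card := k2

theorem IsColouring.exists_misses [Fintype V] {G : SimpleGraph V} [DecidableRel G.Adj] {D : ℕ}
    {c : Sym2 V → Option ℕ} (hc : IsColouring G D c) {v : V} (hv : G.degree v + 1 ≤ D) :
    ∃ κ, (1 ≤ κ ∧ κ ≤ D) ∧ Misses c v κ := by
  by_contra! hcon
  have hex : ∀ κ, ∃ w, κ ∈ Finset.Icc 1 D → c s(v, w) = some κ := by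
    intro κ
    by_cases hκ : κ ∈ Finset.Icc 1 D
    · have := hcon κ (Finset.mem_Icc.1 hκ)
      simp only [Misses, not_forall, not_not] at this
      obtain ⟨w, hw⟩ := this
      exact ⟨w, fun _ => hw⟩
    · exact ⟨v, fun hh => (hκ hh).elim⟩
  choose f hf using hex
  have := Finset.card_le_card_of_injOn (s := Finset.Icc 1 D) (t := G.neighborFinset v) f
    (fun κ hκ => by simpa using hc.adj (hf κ hκ)) fun κ hκ κ' hκ' hh => by
      have h1 := hf κ hκ
      rw [hh, hf κ' hκ', Option.some_inj] at h1
      exact h1.symm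
  rw [Nat.card_Icc, Nat.add_sub_cancel, G.card_neighborFinset_eq_degree] at this
  omega

theorem IsColouring.augments [Fintype V] [DecidableEq V] {G : SimpleGraph V}
    [DecidableRel G.Adj] {D : ℕ} {c : Sym2 V → Option ℕ} (hc : IsColouring G D c)
    (hD : ∀ v, G.degree v + 1 ≤ D) {e : Sym2 V} (he : e ∈ G.edgeSet) (hunc : c e = none) :
    Augments G D c e (1 + (Nat.log 2 (Fintype.card V) + 1) * (D + 24 * D ^ 7)) := by
  choose μ hμD hμ using fun v => hc.exists_misses (hD v)
  by_contra haug
  obtain ⟨A', A, -, -, h, -⟩ := exists_many_holes hD hc hμD hμ he hunc haug _ le_rfl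
  have hDpos : 0 < D := by
    induction e with
    | _ x y => exact (hμD x).1.trans (hμD x).2
  have h1 : Fintype.card V < 2 ^ (Nat.log 2 (Fintype.card V) + 1) :=
    Nat.lt_pow_succ_log_self one_lt_two _
  have h2 : 2 ≤ 6 * D ^ 4 := by
    have := Nat.one_le_pow 4 D hDpos
    omega
  have h3 := Nat.pow_le_pow_left h2 (Nat.log 2 (Fintype.card V) + 1)
  have h4 := A.card_le_univ
  omega

theorem isProperPartialVizing_iff [Fintype V] {G : SimpleGraph V} [DecidableRel G.Adj]
    {c : Sym2 V → Option ℕ} :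
    IsProperPartialVizing G c ↔ IsColouring G (G.maxDegree + 1) c := by
  constructor
  · rintro ⟨⟨h1, h2⟩, h3⟩
    refine ⟨fun h => (h1 _ _ h).1, fun h => ⟨(h1 _ _ h).2, h3 _ _ h⟩, fun {v a b κ} ha hb => ?_⟩
    by_contra hab
    exact h2 s(v, a) s(v, b) κ (fun hh => hab (Sym2.congr_right.1 hh)) ⟨v, by simp, by simp⟩ ha hb
  · intro h
    refine ⟨⟨fun f κ hf => ?_, fun f g κ hne hz hf hg => ?_⟩, fun f κ hf => ?_⟩
    · induction f with
      | _ a b => exact ⟨h.adj hf, (h.bound hf).1⟩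
    · obtain ⟨z, hz1, hz2⟩ := hz
      obtain ⟨a, rfl⟩ := hz1
      obtain ⟨b, rfl⟩ := hz2
      exact hne (by rw [h.inj hf hg])
    · induction f with
      | _ a b => exact (h.bound hf).2

theorem exists_subgraph_edgeSet_eq {G : SimpleGraph V} (S : Set (Sym2 V)) (hS : S ⊆ G.edgeSet) :
    ∃ H : G.Subgraph, H.edgeSet = S := by
  refine ⟨⟨Set.univ, fun a b => s(a, b) ∈ S, fun h => hS h, fun _ => Set.mem_univ _,
    ⟨fun a b h => by rwa [Sym2.eq_swap]⟩⟩, ?_⟩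
  ext f
  induction f with
  | _ a b => rfl

theorem support_bound {Δ n : ℕ} (hΔ : 1 ≤ Δ) (hn : 2 ≤ n) :
    ((1 + (Nat.log 2 n + 1) * (Δ + 1 + 24 * (Δ + 1) ^ 7) : ℕ) : ℝ) ≤
      20000 * (Δ : ℝ) ^ 7 * Real.log n := by
  have hpow : Δ + 1 ≤ (Δ + 1) ^ 7 := Nat.le_self_pow (by norm_num) _
  have hpow' : (Δ + 1) ^ 7 ≤ 128 * Δ ^ 7 :=
    (Nat.pow_le_pow_left (show Δ + 1 ≤ 2 * Δ by omega) 7).trans (le_of_eq (by ring))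
  have hlog : 1 ≤ Nat.log 2 n := Nat.log_pos one_lt_two hn
  have h1 : 1 + (Nat.log 2 n + 1) * (Δ + 1 + 24 * (Δ + 1) ^ 7) ≤
      Nat.log 2 n * (6528 * Δ ^ 7) := by
    have : 1 ≤ Δ ^ 7 := Nat.one_le_pow _ _ hΔ
    calc 1 + (Nat.log 2 n + 1) * (Δ + 1 + 24 * (Δ + 1) ^ 7)
        ≤ Nat.log 2 n * Δ ^ 7 + (2 * Nat.log 2 n) * (3200 * Δ ^ 7) := by
          gcongr
          · exact Nat.mul_pos hlog this
          · omega
          · omega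
      _ ≤ _ := by
        have : 0 ≤ Nat.log 2 n * Δ ^ 7 := Nat.zero_le _
        linarith
  have h2 : (Nat.log 2 n : ℝ) * Real.log 2 ≤ Real.log n := by
    have hp : ((2 : ℕ) ^ Nat.log 2 n : ℝ) ≤ n := by
      exact_mod_cast Nat.pow_log_le_self 2 (by omega)
    have := Real.log_le_log (by positivity) hp
    rwa [Real.log_pow] at this
  have h3 : (Nat.log 2 n : ℝ) ≤ 2 * Real.log n := by
    have := Real.log_two_gt_d9
    have : (0 : ℝ) ≤ Nat.log 2 n := Nat.cast_nonneg _
    nlinarith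
  calc ((1 + (Nat.log 2 n + 1) * (Δ + 1 + 24 * (Δ + 1) ^ 7) : ℕ) : ℝ)
      ≤ ((Nat.log 2 n * (6528 * Δ ^ 7) : ℕ) : ℝ) := by exact_mod_cast h1
    _ = (Nat.log 2 n : ℝ) * (6528 * (Δ : ℝ) ^ 7) := by push_cast; ring
    _ ≤ (2 * Real.log n) * (10000 * (Δ : ℝ) ^ 7) := by
      gcongr
      norm_num
    _ = _ := by ring

end VizingChain

/-- **Small augmenting subgraphs.** There is an absolute constant `C` such that for any
finite simple graph on `n ≥ 2` vertices with maximum degree `Δ ≥ 1`, any proper partial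
`(Δ+1)`-edge colouring `c` and any edge `e` left uncoloured by `c`, there is an
augmenting subgraph `H` for `e` with at most `C * Δ^7 * log n` edges: `H` contains `e`
and there is a proper partial `(Δ+1)`-edge colouring `c'` colouring `e`, colouring every
edge coloured by `c`, and agreeing with `c` outside `H`. -/
theorem small_augmenting_subgraph :
    ∃ C : ℝ, 0 < C ∧
      ∀ (V : Type) [Fintype V] [DecidableEq V] (G : SimpleGraph V) [DecidableRel G.Adj],
        2 ≤ Fintype.card V → 1 ≤ G.maxDegree →
        ∀ c : Sym2 V → Option ℕ, IsProperPartialVizing G c →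
          ∀ e ∈ G.edgeSet, c e = none →
            ∃ H : G.Subgraph, e ∈ H.edgeSet ∧
              (H.edgeSet.ncard : ℝ) ≤
                C * (G.maxDegree : ℝ) ^ 7 * Real.log (Fintype.card V) ∧
              ∃ c' : Sym2 V → Option ℕ, IsProperPartialVizing G c' ∧ c' e ≠ none ∧
                (∀ f, c f ≠ none → c' f ≠ none) ∧
                ∀ f, f ∉ H.edgeSet → c' f = c f := by
  refine ⟨20000, by norm_num, fun V _ _ G _ hn hΔ c hc e he hunc => ?_⟩
  obtain ⟨c', h1, h2, h3, S, h4, h5, h6, h7⟩ :=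
    (VizingChain.isProperPartialVizing_iff.1 hc).augments
      (fun v => Nat.succ_le_succ (G.degree_le_maxDegree v)) he hunc
  obtain ⟨H, hH⟩ := VizingChain.exists_subgraph_edgeSet_eq (G := G) (S : Set (Sym2 V))
    fun f hf => h5 f hf
  refine ⟨H, by rw [hH]; exact h6, ?_, c', VizingChain.isProperPartialVizing_iff.2 h1, h2, h3,
    fun f hf => h7 f (by rwa [hH] at hf)⟩
  rw [hH, Set.ncard_coe_finset]
  exact le_trans (by exact_mod_cast h4) (VizingChain.support_bound hΔ hn)
end
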